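/- arXiv:1007.3007 — 2 statements merged into one kernel-verified Lean document; each statement's English description precedes it below -/
import Mathlib

section
/- Let N ≤ 3 and let B = (β_ij) be a symmetric 2×2 real matrix with β₁₁ ≥ 0 and β₂₂ ≥ 0. Then the system −Δu₁ = β₁₁u₁³ + β₁₂u₂²u₁, −Δu₂ = β₂₂u₂³ + β₁₂u₁²u₂ with u₁, u₂ ≥ 0 on ℝ^N admits a nontrivial solution (a pair of C² nonnegative solutions, not both identically zero) if and only if B is not strictly copositive, i.e. if and only if one of the strict inequalities β₁₁ > 0, β₂₂ > 0, β₁₂ > −√(β₁₁β₂₂) fails. -/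
open Finset

/-- The Laplacian of a function `f : ℝ^N → ℝ`: the sum of the second partial
derivatives in the coordinate directions. -/
noncomputable def laplacian {N : ℕ} (f : (Fin N → ℝ) → ℝ) (x : Fin N → ℝ) : ℝ :=
  ∑ i : Fin N, fderiv ℝ (fun y => fderiv ℝ f y (Pi.single i 1)) x (Pi.single i 1)

open MeasureTheory Filter Topology

lemma lv_alg (a b d : ℝ) (ha : 0 < a) (hd : 0 < d) (hb : -Real.sqrt (a*d) < b) :
    ∃ l1 l2 c : ℝ, 0 < l1 ∧ 0 < l2 ∧ 0 < c ∧ ∀ x y : ℝ, 0 ≤ x → 0 ≤ y →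
      c * (l1*x+l2*y)^3 ≤ l1*(a*x^3+b*y^2*x) + l2*(d*y^3+b*x^2*y) := by
  obtain ⟨m, hm, hma⟩ : ∃ m : ℝ, 0 < m ∧ m^4 = a :=
    ⟨Real.sqrt (Real.sqrt a), by positivity, by
      rw [show 4 = 2*2 from rfl, pow_mul, Real.sq_sqrt (by positivity), Real.sq_sqrt ha.le]⟩
  obtain ⟨n, hn, hnd⟩ : ∃ n : ℝ, 0 < n ∧ n^4 = d :=
    ⟨Real.sqrt (Real.sqrt d), by positivity, by
      rw [show 4 = 2*2 from rfl, pow_mul, Real.sq_sqrt (by positivity), Real.sq_sqrt hd.le]⟩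
  have hs : Real.sqrt (a*d) = m^2*n^2 := by
    rw [← hma, ← hnd, show m^4*n^4 = (m^2*n^2)^2 by ring, Real.sqrt_sq (by positivity)]
  rw [hs] at hb
  -- gam in (0,1] with b ≥ -(1-gam) m^2 n^2
  obtain ⟨g, hg, hg1, hgb⟩ : ∃ g : ℝ, 0 < g ∧ g ≤ 1 ∧ -(1-g)*(m^2*n^2) ≤ b := by
    have hmn : 0 < m^2*n^2 := by positivity
    refine ⟨min 1 ((b+m^2*n^2)/(m^2*n^2)), lt_min one_pos (div_pos (by linarith) hmn), min_le_left _ _, ?_⟩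
    have h : min 1 ((b+m^2*n^2)/(m^2*n^2)) * (m^2*n^2) ≤ b+m^2*n^2 := by
      calc _ ≤ ((b+m^2*n^2)/(m^2*n^2)) * (m^2*n^2) := by gcongr; exact min_le_right _ _
        _ = _ := by field_simp
    linarith
  set k := n/m + m/n with hk
  have hkp : 0 < k := by positivity
  refine ⟨n, m, m*n*g/4/k^3, hn, hm, by positivity, fun x y hx hy => ?_⟩
  have h1 : n*x+m*y ≤ k*(m*x+n*y) := by
    have : k*(m*x+n*y) = n*x+m*y + (m^2/n*x + n^2/m*y) := by rw [hk]; field_simp; ring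
    have : 0 ≤ m^2/n*x + n^2/m*y := by positivity
    linarith
  set X := m*x
  set Y := n*y
  have hX : 0 ≤ X := by positivity
  have hY : 0 ≤ Y := by positivity
  have h2 : m*n*g/4/k^3*(n*x+m*y)^3 ≤ m*n*g/4*(X+Y)^3 := by
    calc _ ≤ m*n*g/4/k^3*(k*(X+Y))^3 := by gcongr
      _ = _ := by field_simp
  have h3 : (X+Y)^3 ≤ 4*(X^3+Y^3) := by nlinarith [mul_nonneg (add_nonneg hX hY) (sq_nonneg (X-Y))]
  have h4 : X*Y*(X+Y) ≤ X^3+Y^3 := by nlinarith [mul_nonneg (add_nonneg hX hY) (sq_nonneg (X-Y))]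
  have h5 : n*(a*x^3+b*y^2*x) + m*(d*y^3+b*x^2*y) = m*n*(X^3+Y^3) + b*(x*y*(X+Y)) := by
    rw [← hma, ← hnd]; simp only [X, Y]; ring
  rw [h5]
  have h6 : -(1-g)*(m^2*n^2) * (x*y*(X+Y)) ≤ b*(x*y*(X+Y)) := by gcongr
  have h7 : -(1-g)*(m^2*n^2) * (x*y*(X+Y)) = -(m*n*(1-g)*(X*Y*(X+Y))) := by simp only [X, Y]; ring
  have h8 : m*n*(1-g)*(X*Y*(X+Y)) ≤ m*n*(1-g)*(X^3+Y^3) := by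
    apply mul_le_mul_of_nonneg_left h4; have : 0 ≤ 1-g := by linarith
    positivity
  have h9 : m*n*g/4*(X+Y)^3 ≤ m*n*g/4*(4*(X^3+Y^3)) := by gcongr
  nlinarith

lemma lv_parts {N : ℕ} (w φ : (Fin N → ℝ) → ℝ) (hw : ContDiff ℝ 2 w) (hφ : ContDiff ℝ 2 φ)
    (hs : HasCompactSupport φ) : ∫ x, φ x * laplacian w x = ∫ x, laplacian φ x * w x := by
  have key : ∀ i : Fin N,
      (∫ x, φ x * fderiv ℝ (fun y => fderiv ℝ w y (Pi.single i 1)) x (Pi.single i 1)) =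
      ∫ x, fderiv ℝ (fun y => fderiv ℝ φ y (Pi.single i 1)) x (Pi.single i 1) * w x := by
    intro i
    have hw1 : ContDiff ℝ 1 (fun y => fderiv ℝ w y (Pi.single i 1)) :=
      (hw.fderiv_right (m := 1) (by norm_num)).clm_apply contDiff_const
    have hφ1 : ContDiff ℝ 1 (fun y => fderiv ℝ φ y (Pi.single i 1)) :=
      (hφ.fderiv_right (m := 1) (by norm_num)).clm_apply contDiff_const
    have hs1 : HasCompactSupport (fun y => fderiv ℝ φ y (Pi.single i 1)) := hs.fderiv_apply ℝ _
    have hs2 := hs1.fderiv_apply ℝ (Pi.single i 1 : Fin N → ℝ)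
    have hw2 : Continuous (fun x => fderiv ℝ (fun y => fderiv ℝ w y (Pi.single i 1)) x (Pi.single i 1)) :=
      (hw1.continuous_fderiv (by norm_num)).clm_apply continuous_const
    have hφ2 : Continuous (fun x => fderiv ℝ (fun y => fderiv ℝ φ y (Pi.single i 1)) x (Pi.single i 1)) :=
      (hφ1.continuous_fderiv (by norm_num)).clm_apply continuous_const
    rw [integral_mul_fderiv_eq_neg_fderiv_mul_of_integrable (μ := volume)]
    · rw [neg_eq_iff_eq_neg]
      rw [integral_mul_fderiv_eq_neg_fderiv_mul_of_integrable (μ := volume)]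
      · exact (hφ2.mul hw.continuous).integrable_of_hasCompactSupport hs2.mul_right
      · exact (hφ1.continuous.mul hw1.continuous).integrable_of_hasCompactSupport hs1.mul_right
      · exact (hφ1.continuous.mul hw.continuous).integrable_of_hasCompactSupport hs1.mul_right
      · exact fun x _ => hφ1.differentiable (by norm_num) x
      · exact fun x _ => hw.differentiable (by norm_num) x
    · exact (hφ1.continuous.mul hw1.continuous).integrable_of_hasCompactSupport hs1.mul_right
    · exact (hφ.continuous.mul hw2).integrable_of_hasCompactSupport hs.mul_right
    · exact (hφ.continuous.mul hw1.continuous).integrable_of_hasCompactSupport hs.mul_right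
    · exact fun x _ => hφ.differentiable (by norm_num) x
    · exact fun x _ => hw1.differentiable (by norm_num) x
  have hint : ∀ (f g : (Fin N → ℝ) → ℝ), ContDiff ℝ 2 f → ContDiff ℝ 2 g → ∀ i : Fin N, Continuous (fun x => g x * fderiv ℝ (fun y => fderiv ℝ f y (Pi.single i 1)) x (Pi.single i 1)) := by
    intro f g hf hg i
    have hw1 : ContDiff ℝ 1 (fun y => fderiv ℝ f y (Pi.single i 1)) :=
      (hf.fderiv_right (m := 1) (by norm_num)).clm_apply contDiff_const
    exact hg.continuous.mul ((hw1.continuous_fderiv (by norm_num)).clm_apply continuous_const)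
  simp only [laplacian, Finset.mul_sum, Finset.sum_mul]
  rw [integral_finsetSum, integral_finsetSum]
  · exact Finset.sum_congr rfl fun i _ => key i
  · intro i _
    have hs2 := (hs.fderiv_apply ℝ (Pi.single i 1 : Fin N → ℝ)).fderiv_apply ℝ (Pi.single i 1 : Fin N → ℝ)
    have := hint φ w hφ hw i
    simp_rw [mul_comm (w _)] at this
    exact this.integrable_of_hasCompactSupport hs2.mul_right
  · intro i _
    exact (hint w φ hw hφ i).integrable_of_hasCompactSupport hs.mul_right

/-- the test function -/
lemma lv_test (N : ℕ) : ∃ (ψ : (Fin N → ℝ) → ℝ) (C : ℝ), 0 < C ∧ ContDiff ℝ 2 ψ ∧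
    (∀ x, 0 ≤ ψ x) ∧ (∀ x, ψ x ≤ 1) ∧ (∀ x, ‖x‖ ≤ 1 → ψ x = 1) ∧ (∀ x, 2 ≤ ‖x‖ → ψ x = 0) ∧
    (∀ x, |laplacian (fun y => ψ y ^ 3) x| ≤ C * ψ x) ∧
    (∀ x, ‖x‖ < 1 → laplacian (fun y => ψ y ^ 3) x = 0) := by
  let f : ContDiffBump (0 : Fin N → ℝ) := ⟨1, 2, one_pos, one_lt_two⟩
  have hf : ContDiff ℝ 2 f := f.contDiff
  have h1 : ∀ i : Fin N, ContDiff ℝ 1 (fun y => fderiv ℝ f y (Pi.single i 1)) := fun i =>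
      (hf.fderiv_right (m := 1) (by norm_num)).clm_apply contDiff_const
  let h : (Fin N → ℝ) → ℝ := fun x => ∑ i, (3 * f x * fderiv ℝ (fun y => fderiv ℝ f y (Pi.single i 1)) x (Pi.single i 1) + 6 * (fderiv ℝ f x (Pi.single i 1))^2)
  have hlap : ∀ x, laplacian (fun y => f y ^ 3) x = h x * f x := by
    intro x
    simp only [laplacian, h, Finset.sum_mul]
    refine Finset.sum_congr rfl fun i _ => ?_
    have e1 : (fun y => fderiv ℝ (fun y => f y ^ 3) y (Pi.single i 1)) = fun y => 3 * f y ^ 2 * fderiv ℝ f y (Pi.single i 1) := by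
      ext y
      have := ((hf.differentiable (by norm_num) y).hasFDerivAt.pow 3).fderiv
      rw [this]; simp
    rw [e1]
    have d1 : HasFDerivAt f (fderiv ℝ f x) x := (hf.differentiable (by norm_num) x).hasFDerivAt
    have d2 := ((h1 i).differentiable (by norm_num) x).hasFDerivAt
    have := (((d1.pow 2).const_mul 3).mul d2).fderiv
    rw [show (fun y => 3 * f y ^ 2 * fderiv ℝ f y (Pi.single i 1)) = (fun y => 3 * f y ^ 2) * (fun y => fderiv ℝ f y (Pi.single i 1)) from rfl]
    rw [this]; simp; ring
  have hcont : Continuous h := by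
    refine continuous_finsetSum _ fun i _ => ?_
    have := ((h1 i).continuous_fderiv (by norm_num)).clm_apply (continuous_const (y := (Pi.single i 1 : Fin N → ℝ)))
    have := hf.continuous
    have := (h1 i).continuous
    fun_prop
  obtain ⟨C, hC⟩ := (isCompact_closedBall (0 : Fin N → ℝ) 2).exists_bound_of_continuousOn hcont.continuousOn
  have hz : ∀ x, 2 ≤ ‖x‖ → f x = 0 := fun x hx => f.zero_of_le_dist (by simpa [f] using hx)
  refine ⟨f, max C 1, by positivity, hf, fun x => f.nonneg, fun x => f.le_one, fun x hx => f.one_of_mem_closedBall (by simpa [f] using hx), hz, ?_, ?_⟩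
  · intro x
    rw [hlap]
    rcases le_or_gt 2 ‖x‖ with h2 | h2
    · simp [hz x h2]
    · rw [abs_mul, abs_of_nonneg (f.nonneg (x := x))]
      gcongr
      · exact f.nonneg
      · exact (hC x (by simpa using h2.le)).trans (le_max_left _ _)
  · intro x hx
    have hev : ∀ᶠ z in 𝓝 x, (fun y => f y ^ 3) z = 1 := by
      have : Metric.ball (0 : Fin N → ℝ) 1 ∈ 𝓝 x := Metric.isOpen_ball.mem_nhds (by simpa using hx)
      filter_upwards [this] with z hz
      have : f z = 1 := f.one_of_mem_closedBall (by simp [f] at hz ⊢; exact hz.le)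
      simp [this]
    simp only [laplacian]
    refine Finset.sum_eq_zero fun i _ => ?_
    have : (fun y => fderiv ℝ (fun y => f y ^ 3) y (Pi.single i 1)) =ᶠ[𝓝 x] fun _ => 0 := by
      filter_upwards [hev.eventually_nhds] with z hz
      have : (fun y => f y ^ 3) =ᶠ[𝓝 z] fun _ => 1 := hz
      rw [this.fderiv_eq]; simp
    rw [this.fderiv_eq]; simp

lemma lv_scale {N : ℕ} (g : (Fin N → ℝ) → ℝ) (hg : ContDiff ℝ 2 g) (r : ℝ) (x : Fin N → ℝ) :
    laplacian (fun y => g (r • y)) x = r^2 * laplacian g (r • x) := by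
  simp only [laplacian, Finset.mul_sum]
  refine Finset.sum_congr rfl fun i _ => ?_
  have hl : ∀ y : Fin N → ℝ, HasFDerivAt (fun y : Fin N → ℝ => r • y) (r • ContinuousLinearMap.id ℝ (Fin N → ℝ)) y :=
    fun y => (hasFDerivAt_id y).const_smul r
  have e1 : (fun y => fderiv ℝ (fun y => g (r • y)) y (Pi.single i 1)) = fun y => r * fderiv ℝ g (r • y) (Pi.single i 1) := by
    ext y
    have := ((hg.differentiable (by norm_num) (r • y)).hasFDerivAt.comp y (hl y)).fderiv
    simp only [Function.comp_def] at this
    rw [this]; simp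
  rw [e1]
  have h1 : ContDiff ℝ 1 (fun y => fderiv ℝ g y (Pi.single i 1)) :=
      (hg.fderiv_right (m := 1) (by norm_num)).clm_apply contDiff_const
  have := (((h1.differentiable (by norm_num) (r • x)).hasFDerivAt.comp x (hl x)).const_mul r).fderiv
  simp only [Function.comp_def] at this
  rw [this]; simp; ring


lemma lv_young (X Y e : ℝ) (hX : 0 ≤ X) (hY : 0 ≤ Y) (he : 0 < e) :
    X * Y^2 ≤ (e^2)⁻¹ * X^3 + e * Y^3 := by
  rcases le_or_gt X (e*Y) with h | h
  · have : 0 ≤ (e^2)⁻¹ * X^3 := by positivity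
    have : X * Y^2 ≤ e*Y*Y^2 := by gcongr
    linarith [show e*Y*Y^2 = e*Y^3 by ring]
  · have : 0 ≤ e * Y^3 := by positivity
    have h2 : X * (e*Y)^2 ≤ X * X^2 := by gcongr
    have : X * Y^2 = (e^2)⁻¹ * (X*(e*Y)^2) := by field_simp
    rw [this]
    have : (e^2)⁻¹ * (X*(e*Y)^2) ≤ (e^2)⁻¹ * (X*X^2) := by gcongr
    linarith [show (e^2)⁻¹ * (X*X^2) = (e^2)⁻¹ * X^3 by ring]

lemma lv_est {N : ℕ} (hN : N ≤ 3) (w : (Fin N → ℝ) → ℝ) (hw : ContDiff ℝ 2 w) (hw0 : ∀ x, 0 ≤ w x)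
    (c : ℝ) (hsup : ∀ x, c * w x ^ 3 ≤ -laplacian w x) :
    ∃ C : ℝ, 0 < C ∧ ∀ R : ℝ, 1 ≤ R → ∃ φ : (Fin N → ℝ) → ℝ, Continuous φ ∧ HasCompactSupport φ ∧
      (∀ x, 0 ≤ φ x) ∧ (∀ x, φ x ≤ 1) ∧ (∀ x, ‖x‖ ≤ R → φ x = 1) ∧
      ∀ e : ℝ, 0 < e → c * ∫ x, w x ^ 3 * φ x ≤
        C * (e^2)⁻¹ * (∫ x in (Metric.closedBall 0 R)ᶜ, w x ^ 3 * φ x) + C * e := by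
  obtain ⟨ψ, C, hC, hψ, hψ0, hψ1, hψ2, hψ3, hl1, hl2⟩ := lv_test N
  refine ⟨C * 64, by positivity, fun R hR => ?_⟩
  have hRp : 0 < R := by linarith
  have hnorm : ∀ x : Fin N → ℝ, ‖R⁻¹ • x‖ = R⁻¹ * ‖x‖ := fun x => by
    rw [norm_smul, Real.norm_of_nonneg (by positivity)]
  set φ : (Fin N → ℝ) → ℝ := fun x => ψ (R⁻¹ • x) ^ 3 with hφdef
  have hψ33 : ContDiff ℝ 2 (fun y => ψ y ^ 3) := hψ.pow 3
  have hφ : ContDiff ℝ 2 φ := hψ33.comp (contDiff_const_smul R⁻¹)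
  have hz : ∀ x : Fin N → ℝ, 2 * R ≤ ‖x‖ → ψ (R⁻¹ • x) = 0 := fun x hx => hψ3 _ (by
    rw [hnorm, inv_mul_eq_div, le_div_iff₀ hRp]; exact hx)
  have hsupp : HasCompactSupport φ := by
    refine HasCompactSupport.intro (isCompact_closedBall (0 : Fin N → ℝ) (2*R)) fun x hx => ?_
    simp only [Metric.mem_closedBall, dist_zero_right, not_le] at hx
    simp [φ, hz x hx.le]
  have hφ0 : ∀ x, 0 ≤ φ x := fun x => pow_nonneg (hψ0 _) 3
  refine ⟨φ, hφ.continuous, hsupp, hφ0, fun x => pow_le_one₀ (hψ0 _) (hψ1 _), ?_, ?_⟩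
  · intro x hx
    have : ψ (R⁻¹ • x) = 1 := hψ2 _ (by rw [hnorm, inv_mul_eq_div, div_le_one hRp]; exact hx)
    simp [φ, this]
  intro e he
  have hlapc : ∀ (f : (Fin N → ℝ) → ℝ), ContDiff ℝ 2 f → Continuous (laplacian f) := by
    intro f hf
    refine continuous_finsetSum _ fun i _ => ?_
    have hw1 : ContDiff ℝ 1 (fun y => fderiv ℝ f y (Pi.single i 1)) :=
      (hf.fderiv_right (m := 1) (by norm_num)).clm_apply contDiff_const
    exact (hw1.continuous_fderiv (by norm_num)).clm_apply continuous_const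
  have hi1 : Integrable (fun x => w x ^ 3 * φ x) :=
    ((hw.continuous.pow 3).mul hφ.continuous).integrable_of_hasCompactSupport hsupp.mul_left
  have hi2 : Integrable (fun x => φ x * laplacian w x) :=
    (hφ.continuous.mul (hlapc w hw)).integrable_of_hasCompactSupport hsupp.mul_right
  have hL : ∀ x, laplacian φ x = R⁻¹^2 * laplacian (fun y => ψ y ^ 3) (R⁻¹ • x) :=
    fun x => lv_scale _ hψ33 R⁻¹ x
  have hlz : ∀ x : Fin N → ℝ, 2 * R ≤ ‖x‖ → laplacian φ x = 0 := fun x hx => by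
    have := hl1 (R⁻¹ • x)
    rw [hz x hx, mul_zero, abs_nonpos_iff] at this
    rw [hL, this, mul_zero]
  have hi3 : Integrable (fun x => laplacian φ x * w x) := by
    refine ((hlapc φ hφ).mul hw.continuous).integrable_of_hasCompactSupport (HasCompactSupport.mul_right ?_)
    refine HasCompactSupport.intro (isCompact_closedBall (0 : Fin N → ℝ) (2*R)) fun x hx => ?_
    simp only [Metric.mem_closedBall, dist_zero_right, not_le] at hx
    exact hlz x hx.le
  let G1 : (Fin N → ℝ) → ℝ := (Metric.closedBall 0 R)ᶜ.indicator (fun x => C * (e^2)⁻¹ * (w x ^ 3 * φ x))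
  let G2 : (Fin N → ℝ) → ℝ := (Metric.closedBall 0 (2*R)).indicator (fun x => C * (e * R⁻¹^3))
  have hm1 : MeasurableSet (Metric.closedBall (0 : Fin N → ℝ) R)ᶜ := Metric.isClosed_closedBall.measurableSet.compl
  have hm2 : MeasurableSet (Metric.closedBall (0 : Fin N → ℝ) (2*R)) := Metric.isClosed_closedBall.measurableSet
  have hG1 : Integrable G1 := (hi1.const_mul _).indicator hm1
  have hG2 : Integrable G2 := (integrable_indicator_iff hm2).2 (integrableOn_const (measure_closedBall_lt_top.ne))
  have hae : ∀ᵐ x : Fin N → ℝ, ‖x‖ ≠ R := by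
    have : volume (Metric.sphere (0 : Fin N → ℝ) R) = 0 := Measure.addHaar_sphere_of_ne_zero _ _ hRp.ne'
    have := measure_eq_zero_iff_ae_notMem.1 this
    filter_upwards [this] with x hx
    simpa using hx
  have hpt : ∀ᵐ x, -(laplacian φ x * w x) ≤ G1 x + G2 x := by
    filter_upwards [hae] with x hxR
    have hG1n : 0 ≤ G1 x := Set.indicator_nonneg (fun x _ => by have := hw0 x; have := hφ0 x; positivity) x
    have hG2n : 0 ≤ G2 x := Set.indicator_nonneg (fun x _ => by positivity) x
    rcases lt_or_gt_of_ne hxR with h | h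
    · have : laplacian φ x = 0 := by
        rw [hL, hl2, mul_zero]; rw [hnorm, inv_mul_eq_div, div_lt_one hRp]; exact h
      rw [this]; simp; linarith
    rcases le_or_gt ‖x‖ (2*R) with h' | h'
    · have e1 : G1 x = C * (e^2)⁻¹ * (w x ^ 3 * φ x) := Set.indicator_of_mem (by simpa using h) _
      have e2 : G2 x = C * (e * R⁻¹^3) := Set.indicator_of_mem (by simpa using h') _
      rw [e1, e2]
      have b1 : -(laplacian φ x * w x) ≤ R⁻¹^2 * (C * ψ (R⁻¹ • x)) * w x := by
        rw [← neg_mul]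
        apply mul_le_mul_of_nonneg_right _ (hw0 x)
        rw [hL, ← mul_neg]
        gcongr
        exact (neg_le_abs _).trans (hl1 _)
      have b2 := lv_young (w x * ψ (R⁻¹ • x)) R⁻¹ e (mul_nonneg (hw0 x) (hψ0 _)) (by positivity) he
      calc _ ≤ _ := b1
        _ = C * (w x * ψ (R⁻¹ • x) * R⁻¹^2) := by ring
        _ ≤ C * ((e^2)⁻¹ * (w x * ψ (R⁻¹ • x))^3 + e * R⁻¹^3) := by gcongr
        _ = _ := by simp only [φ]; ring
    · rw [hlz x h'.le]; simp; linarith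
  have s1 : c * ∫ x, w x ^ 3 * φ x ≤ ∫ x, -(φ x * laplacian w x) := by
    rw [← integral_const_mul]
    refine integral_mono (hi1.const_mul _) hi2.neg fun x => ?_
    have := mul_le_mul_of_nonneg_left (hsup x) (hφ0 x)
    simp only
    linarith
  have s2 : ∫ x, -(φ x * laplacian w x) = ∫ x, -(laplacian φ x * w x) := by
    rw [integral_neg, integral_neg, lv_parts w φ hw hφ hsupp]
  have s3 : ∫ x, -(laplacian φ x * w x) ≤ ∫ x, (G1 x + G2 x) := integral_mono_ae hi3.neg (hG1.add hG2) hpt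
  have s4 : ∫ x, (G1 x + G2 x) = C * (e^2)⁻¹ * (∫ x in (Metric.closedBall 0 R)ᶜ, w x ^ 3 * φ x) + (volume.real (Metric.closedBall (0 : Fin N → ℝ) (2*R))) * (C * (e * R⁻¹^3)) := by
    rw [integral_add hG1 hG2, integral_indicator hm1, integral_indicator hm2, integral_const_mul, setIntegral_const, smul_eq_mul]
  have s5 : volume.real (Metric.closedBall (0 : Fin N → ℝ) (2*R)) ≤ 64 * R^3 := by
    rw [Measure.real, Real.volume_pi_closedBall _ (by positivity), ENNReal.toReal_ofReal (by positivity), Fintype.card_fin]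
    calc (2*(2*R))^N ≤ (2*(2*R))^3 := pow_le_pow_right₀ (by linarith) hN
      _ = _ := by ring
  have s6 : (volume.real (Metric.closedBall (0 : Fin N → ℝ) (2*R))) * (C * (e * R⁻¹^3)) ≤ C * 64 * e := by
    calc _ ≤ 64 * R^3 * (C * (e * R⁻¹^3)) := by gcongr
      _ = _ := by field_simp
  have s7 : 0 ≤ ∫ x in (Metric.closedBall 0 R)ᶜ, w x ^ 3 * φ x :=
    integral_nonneg fun x => mul_nonneg (pow_nonneg (hw0 x) 3) (hφ0 x)
  have s8 : C * (e^2)⁻¹ * (∫ x in (Metric.closedBall 0 R)ᶜ, w x ^ 3 * φ x) ≤ C * 64 * (e^2)⁻¹ * (∫ x in (Metric.closedBall 0 R)ᶜ, w x ^ 3 * φ x) := by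
    apply mul_le_mul_of_nonneg_right _ s7
    gcongr; linarith
  linarith

lemma lv_main {N : ℕ} (hN : N ≤ 3) (w : (Fin N → ℝ) → ℝ) (hw : ContDiff ℝ 2 w) (hw0 : ∀ x, 0 ≤ w x)
    (c : ℝ) (hc : 0 < c) (hsup : ∀ x, c * w x ^ 3 ≤ -laplacian w x) : ∀ x, w x = 0 := by
  obtain ⟨C, hC, hest⟩ := lv_est hN w hw hw0 c hsup
  have hw3 : Continuous (fun x => w x ^ 3) := hw.continuous.pow 3
  have hn : ∀ x, 0 ≤ w x ^ 3 := fun x => pow_nonneg (hw0 x) 3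
  have hion : ∀ R : ℝ, IntegrableOn (fun x => w x ^ 3) (Metric.closedBall 0 R) := fun R =>
    hw3.continuousOn.integrableOn_compact (isCompact_closedBall _ _)
  have hle : ∀ (R : ℝ) (φ : (Fin N → ℝ) → ℝ), Continuous φ → HasCompactSupport φ → (∀ x, 0 ≤ φ x) →
      (∀ x, ‖x‖ ≤ R → φ x = 1) → ∫ x in Metric.closedBall 0 R, w x ^ 3 ≤ ∫ x, w x ^ 3 * φ x := by
    intro R φ h1 h2 h3 h4
    rw [setIntegral_congr_fun (g := fun x => w x ^ 3 * φ x) Metric.isClosed_closedBall.measurableSet]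
    · exact setIntegral_le_integral ((hw3.mul h1).integrable_of_hasCompactSupport h2.mul_left)
        (Eventually.of_forall fun x => mul_nonneg (hn x) (h3 x))
    · intro x hx
      simp [h4 x (by simpa using hx)]
  have hcov : AECover (volume : Measure (Fin N → ℝ)) atTop (fun n : ℕ => Metric.closedBall (0 : Fin N → ℝ) (n+1 : ℝ)) :=
    aecover_closedBall (tendsto_atTop_add_const_right _ _ tendsto_natCast_atTop_atTop)
  -- step 1
  have hint : Integrable (fun x => w x ^ 3) := by
    set e := Real.sqrt (2*C/c) with he
    have hep : 0 < e := by positivity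
    have he2 : e^2 = 2*C/c := Real.sq_sqrt (by positivity)
    refine hcov.integrable_of_integral_bounded_of_nonneg_ae (2*C*e/c) (fun n => hion _) (Eventually.of_forall hn) (Eventually.of_forall fun n => ?_)
    obtain ⟨φ, h1, h2, h3, h4, h5, h6⟩ := hest (n+1) (by linarith [Nat.cast_nonneg (α := ℝ) n])
    refine (hle _ φ h1 h2 h3 h5).trans ?_
    have h7 := h6 e hep
    have h8 : ∫ x in (Metric.closedBall 0 (n+1 : ℝ))ᶜ, w x ^ 3 * φ x ≤ ∫ x, w x ^ 3 * φ x :=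
      setIntegral_le_integral ((hw3.mul h1).integrable_of_hasCompactSupport h2.mul_left)
        (Eventually.of_forall fun x => mul_nonneg (hn x) (h3 x))
    have h9 : C * (e^2)⁻¹ = c/2 := by rw [he2]; field_simp
    rw [h9] at h7
    rw [le_div_iff₀ hc]
    nlinarith
  have hlim := hcov.integral_tendsto_of_countably_generated hint
  set I := ∫ x, w x ^ 3 with hI
  have hIe : ∀ e : ℝ, 0 < e → c * I ≤ C * e := by
    intro e he
    have hb : ∀ n : ℕ, c * (∫ x in Metric.closedBall 0 (n+1:ℝ), w x ^ 3) ≤ C * (e^2)⁻¹ * (I - ∫ x in Metric.closedBall 0 (n+1:ℝ), w x ^ 3) + C * e := by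
      intro n
      obtain ⟨φ, h1, h2, h3, h4, h5, h6⟩ := hest (n+1) (by linarith [Nat.cast_nonneg (α := ℝ) n])
      have h7 := h6 e he
      have h8 := hle _ φ h1 h2 h3 h5
      have h9 : ∫ x in (Metric.closedBall 0 (n+1 : ℝ))ᶜ, w x ^ 3 * φ x ≤ ∫ x in (Metric.closedBall 0 (n+1 : ℝ))ᶜ, w x ^ 3 := by
        refine integral_mono ((hw3.mul h1).integrable_of_hasCompactSupport h2.mul_left).integrableOn hint.integrableOn fun x => ?_
        exact mul_le_of_le_one_right (hn x) (h4 x)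
      have h10 := integral_add_compl (Metric.isClosed_closedBall (x := (0 : Fin N → ℝ)) (ε := (n+1:ℝ))).measurableSet hint
      have h11 : ∫ x in (Metric.closedBall 0 (n+1 : ℝ))ᶜ, w x ^ 3 * φ x ≤ I - ∫ x in Metric.closedBall 0 (n+1:ℝ), w x ^ 3 := by
        rw [hI, ← h10]; linarith
      have h12 : C * (e^2)⁻¹ * (∫ x in (Metric.closedBall 0 (n+1 : ℝ))ᶜ, w x ^ 3 * φ x) ≤ C * (e^2)⁻¹ * (I - ∫ x in Metric.closedBall 0 (n+1:ℝ), w x ^ 3) := by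
        gcongr
      have h13 := mul_le_mul_of_nonneg_left h8 hc.le
      linarith
    have := le_of_tendsto_of_tendsto' (hlim.const_mul c) (((hlim.const_sub I).const_mul (C * (e^2)⁻¹)).add_const (C*e)) hb
    simpa using this
  have hI0 : I = 0 := by
    apply le_antisymm _ (integral_nonneg hn)
    by_contra hpos
    push Not at hpos
    have := hIe (c*I/(2*C)) (by positivity)
    have h2 : C * (c*I/(2*C)) = c*I/2 := by field_simp
    have : 0 < c * I := by positivity
    linarith
  have hz := (integral_eq_zero_iff_of_nonneg hn hint).1 hI0
  have hz' : (fun x => w x ^ 3) = 0 := (hw3.ae_eq_iff_eq volume continuous_const).1 hz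
  intro x
  have := congrFun hz' x
  simpa using this

open MeasureTheory Filter Topology

/-- phase space -/
abbrev PS : Type := ℝ × ℝ × ℝ × ℝ

/-- solution on `[0,T]` -/
def IsSol (F : PS → PS) (x : ℝ → PS) (T : ℝ) (x0 : PS) : Prop :=
  x 0 = x0 ∧ ∀ t ∈ Set.Icc 0 T, HasDerivWithinAt x (F (x t)) (Set.Icc 0 T) t

/-- locally Lipschitz on balls -/
def LipB (F : PS → PS) : Prop := ∀ R : ℝ, ∃ K : NNReal, LipschitzOnWith K F (Metric.closedBall 0 R)

lemma IsSol.mono {F : PS → PS} {x : ℝ → PS} {T T' : ℝ} {x0 : PS} (h : IsSol F x T x0) (hT : T' ≤ T) :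
    IsSol F x T' x0 :=
  ⟨h.1, fun t ht => (h.2 t ⟨ht.1, ht.2.trans hT⟩).mono (Set.Icc_subset_Icc_right hT)⟩

lemma IsSol.cont {F : PS → PS} {x : ℝ → PS} {T : ℝ} {x0 : PS} (h : IsSol F x T x0) :
    ContinuousOn x (Set.Icc 0 T) := fun t ht => (h.2 t ht).continuousWithinAt

lemma IsSol.right {F : PS → PS} {x : ℝ → PS} {T : ℝ} {x0 : PS} (h : IsSol F x T x0) :
    ∀ t ∈ Set.Ico 0 T, HasDerivWithinAt x (F (x t)) (Set.Ici t) t := by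
  intro t ht
  exact (h.2 t ⟨ht.1, ht.2.le⟩).mono_of_mem_nhdsWithin (Icc_mem_nhdsGE_of_mem ht)

/-- clamp -/
noncomputable def cl (R : ℝ) (x : ℝ) : ℝ := max (-R) (min R x)

/-- clamp in phase space -/
noncomputable def clP (R : ℝ) (x : PS) : PS := (cl R x.1, cl R x.2.1, cl R x.2.2.1, cl R x.2.2.2)

lemma cl_lip (R : ℝ) : LipschitzWith 1 (cl R) := by
  have := ((LipschitzWith.id (α := ℝ)).const_min R).const_max (-R)
  exact this

lemma clP_lip (R : ℝ) : LipschitzWith 1 (clP R) := by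
  have h1 : LipschitzWith 1 (fun x : PS => x.1) := LipschitzWith.prod_fst
  have h2 : LipschitzWith 1 (fun x : PS => x.2) := LipschitzWith.prod_snd
  have h3 : LipschitzWith 1 (fun x : ℝ × ℝ × ℝ => x.1) := LipschitzWith.prod_fst
  have h4 : LipschitzWith 1 (fun x : ℝ × ℝ × ℝ => x.2) := LipschitzWith.prod_snd
  have h5 : LipschitzWith 1 (fun x : ℝ × ℝ => x.1) := LipschitzWith.prod_fst
  have h6 : LipschitzWith 1 (fun x : ℝ × ℝ => x.2) := LipschitzWith.prod_snd
  have c := cl_lip R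
  have := (c.comp h1).prodMk ((c.comp (h3.comp h2)).prodMk ((c.comp (h5.comp (h4.comp h2))).prodMk (c.comp (h6.comp (h4.comp h2)))))
  simp only [max_self, mul_one] at this
  exact this

lemma cl_abs {R : ℝ} (hR : 0 ≤ R) (x : ℝ) : |cl R x| ≤ R := by
  rw [abs_le]; simp only [cl]
  exact ⟨le_max_left _ _, max_le (by linarith) (min_le_left _ _)⟩

lemma cl_eq {R : ℝ} {x : ℝ} (h : |x| ≤ R) : cl R x = x := by
  rw [abs_le] at h; simp only [cl]
  rw [min_eq_right h.2, max_eq_right h.1]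

lemma PS_norm_le {x : PS} {R : ℝ} : ‖x‖ ≤ R ↔ |x.1| ≤ R ∧ |x.2.1| ≤ R ∧ |x.2.2.1| ≤ R ∧ |x.2.2.2| ≤ R := by
  simp [Prod.norm_def, Real.norm_eq_abs]

lemma clP_mem {R : ℝ} (hR : 0 ≤ R) (x : PS) : clP R x ∈ Metric.closedBall (0 : PS) R := by
  rw [mem_closedBall_zero_iff, PS_norm_le]
  exact ⟨cl_abs hR _, cl_abs hR _, cl_abs hR _, cl_abs hR _⟩

lemma clP_eq {R : ℝ} {x : PS} (h : ‖x‖ ≤ R) : clP R x = x := by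
  rw [PS_norm_le] at h
  obtain ⟨h1, h2, h3, h4⟩ := h
  simp only [clP, cl_eq h1, cl_eq h2, cl_eq h3, cl_eq h4]

lemma trunc_lip {F : PS → PS} (hF : LipB F) {R : ℝ} (hR : 0 ≤ R) :
    ∃ K : NNReal, LipschitzWith K (fun x => F (clP R x)) := by
  obtain ⟨K, hK⟩ := hF R
  refine ⟨K * 1, ?_⟩
  rw [← lipschitzOnWith_univ]
  exact hK.comp (clP_lip R).lipschitzOnWith (fun x _ => clP_mem hR x)

lemma trunc_exists {F : PS → PS} (hF : LipB F) {R : ℝ} (hR : 0 ≤ R) (x0 : PS) {T : ℝ} (hT : 0 ≤ T) :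
    ∃ x, IsSol (fun x => F (clP R x)) x T x0 := by
  obtain ⟨K, hK⟩ := trunc_lip hF hR
  have hcomp : IsCompact (Metric.closedBall (0 : PS) R) := isCompact_closedBall _ _
  obtain ⟨K', hK'⟩ := hF R
  obtain ⟨L, hL⟩ := hcomp.exists_bound_of_continuousOn hK'.continuousOn
  have hpl : IsPicardLindelof (fun _ x => F (clP R x)) (⟨0, le_rfl, hT⟩ : Set.Icc (0:ℝ) T) x0
      (Real.toNNReal L * Real.toNNReal T) 0 (Real.toNNReal L) K := by
    refine ⟨fun t _ => hK.lipschitzOnWith, fun x _ => continuousOn_const, fun t _ x _ => ?_, ?_⟩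
    · exact (hL _ (clP_mem hR x)).trans (Real.le_coe_toNNReal L)
    · simp [hT]
  exact hpl.exists_eq_forall_mem_Icc_hasDerivWithinAt₀

lemma IsSol.of_trunc {F : PS → PS} {R : ℝ} {x : ℝ → PS} {T : ℝ} {x0 : PS}
    (h : IsSol (fun x => F (clP R x)) x T x0) (hb : ∀ t ∈ Set.Icc 0 T, ‖x t‖ ≤ R) : IsSol F x T x0 :=
  ⟨h.1, fun t ht => by have := h.2 t ht; simp only [clP_eq (hb t ht)] at this; exact this⟩

lemma IsSol.to_trunc {F : PS → PS} {R : ℝ} {x : ℝ → PS} {T : ℝ} {x0 : PS}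
    (h : IsSol F x T x0) (hb : ∀ t ∈ Set.Icc 0 T, ‖x t‖ ≤ R) : IsSol (fun x => F (clP R x)) x T x0 :=
  ⟨h.1, fun t ht => by simp only [clP_eq (hb t ht)]; exact h.2 t ht⟩

/-- continuity induction -/
lemma cont_ind {f : ℝ → ℝ} {a b : ℝ} (hf : ContinuousOn f (Set.Icc a b))
    (h : ∀ t ∈ Set.Icc a b, (∀ τ ∈ Set.Ico a t, 0 < f τ) → 0 < f t) : ∀ t ∈ Set.Icc a b, 0 < f t := by
  by_contra hcon
  push Not at hcon
  obtain ⟨t, ht, hft⟩ := hcon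
  have hcl : IsClosed (Set.Icc a b ∩ f ⁻¹' Set.Iic 0) := hf.preimage_isClosed_of_isClosed isClosed_Icc isClosed_Iic
  have hcpt : IsCompact (Set.Icc a b ∩ f ⁻¹' Set.Iic 0) := isCompact_Icc.of_isClosed_subset hcl Set.inter_subset_left
  obtain ⟨m, ⟨hm, hfm⟩, hmin⟩ := hcpt.exists_isLeast ⟨t, ht, hft⟩
  have := h m hm fun τ hτ => by
    by_contra hc
    have := hmin ⟨⟨hτ.1, hτ.2.le.trans hm.2⟩, not_lt.1 hc⟩
    linarith [hτ.2]
  exact absurd hfm (not_le.2 this)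

lemma IsSol.bdd {F : PS → PS} {x : ℝ → PS} {T : ℝ} {x0 : PS} (h : IsSol F x T x0) :
    ∃ R : ℝ, 0 ≤ R ∧ ∀ t ∈ Set.Icc 0 T, ‖x t‖ ≤ R := by
  obtain ⟨R, hR⟩ := isCompact_Icc.exists_bound_of_continuousOn h.cont
  exact ⟨max R 0, le_max_right _ _, fun t ht => (hR t ht).trans (le_max_left _ _)⟩

lemma sol_stab {F : PS → PS} (hF : LipB F) {x : ℝ → PS} {T : ℝ} (hT : 0 ≤ T) {x0 : PS} (h : IsSol F x T x0)
    {e : ℝ} (he : 0 < e) : ∃ δ > 0, ∀ y0, dist y0 x0 < δ → ∃ y, IsSol F y T y0 ∧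
      ∀ t ∈ Set.Icc 0 T, dist (y t) (x t) < e := by
  obtain ⟨R, hR, hb⟩ := h.bdd
  obtain ⟨K, hK⟩ := trunc_lip hF (by linarith : 0 ≤ R + 1)
  set e' := min e 1 with he'
  have he'p : 0 < e' := lt_min he one_pos
  refine ⟨e' / Real.exp (K * T), by positivity, fun y0 hy0 => ?_⟩
  obtain ⟨y, hy⟩ := trunc_exists hF (by linarith : 0 ≤ R + 1) y0 hT
  have hx := h.to_trunc (R := R+1) (fun t ht => (hb t ht).trans (by linarith))
  have key : ∀ t ∈ Set.Icc 0 T, dist (y t) (x t) < e' := by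
    intro t ht
    have := dist_le_of_trajectories_ODE (v := fun _ x => F (clP (R+1) x)) (fun _ => hK) hy.cont hy.right hx.cont hx.right
      (by rw [hy.1, hx.1]) t ht
    refine this.trans_lt ?_
    calc dist y0 x0 * Real.exp (K * (t-0)) ≤ dist y0 x0 * Real.exp (K * T) := by
          gcongr; linarith [ht.2]
      _ < e' / Real.exp (K * T) * Real.exp (K * T) := by gcongr
      _ = e' := by field_simp
  refine ⟨y, hy.of_trunc fun t ht => ?_, fun t ht => (key t ht).trans_le (min_le_left _ _)⟩
  have h1 := key t ht
  have h2 := hb t ht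
  have h3 : e' ≤ 1 := min_le_right _ _
  rw [dist_eq_norm] at h1
  have : ‖y t‖ ≤ ‖y t - x t‖ + ‖x t‖ := by simpa using norm_add_le (y t - x t) (x t)
  linarith

lemma sol_unique {F : PS → PS} (hF : LipB F) {x y : ℝ → PS} {T : ℝ} {x0 : PS} (hx : IsSol F x T x0)
    (hy : IsSol F y T x0) : ∀ t ∈ Set.Icc 0 T, x t = y t := by
  obtain ⟨R, hR, hb⟩ := hx.bdd
  obtain ⟨R', hR', hb'⟩ := hy.bdd
  obtain ⟨K, hK⟩ := trunc_lip hF (by linarith : 0 ≤ R + R')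
  have h1 := hx.to_trunc (R := R+R') (fun t ht => (hb t ht).trans (by linarith))
  have h2 := hy.to_trunc (R := R+R') (fun t ht => (hb' t ht).trans (by linarith))
  intro t ht
  have := dist_le_of_trajectories_ODE (v := fun _ x => F (clP (R+R') x)) (δ := 0) (fun _ => hK) h1.cont h1.right h2.cont h2.right
      (by rw [h1.1, h2.1]; simp) t ht
  simpa using this

lemma sol_exists {F : PS → PS} (hF : LipB F) {T : ℝ} (hT : 0 ≤ T) {x0 : PS} {R : ℝ} (hR : 0 ≤ R)
    (hb : ∀ T' ∈ Set.Icc 0 T, ∀ x, IsSol F x T' x0 → ‖x T'‖ ≤ R) (hx0 : ‖x0‖ ≤ R) : ∃ x, IsSol F x T x0 := by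
  obtain ⟨x, hx⟩ := trunc_exists hF (by linarith : 0 ≤ R + 1) x0 hT
  have key : ∀ t ∈ Set.Icc 0 T, 0 < R + 1 - ‖x t‖ := by
    refine cont_ind (continuousOn_const.sub hx.cont.norm) fun t ht hτ => ?_
    rcases eq_or_lt_of_le ht.1 with h0 | h0
    · rw [← h0, hx.1]; linarith
    have hle : ∀ τ ∈ Set.Icc 0 t, ‖x τ‖ ≤ R + 1 := by
      have hcc : ContinuousOn (fun τ => ‖x τ‖) (closure (Set.Ico 0 t)) := by
        rw [closure_Ico h0.ne]
        exact hx.cont.norm.mono (Set.Icc_subset_Icc_right ht.2)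
      intro τ h
      rw [← closure_Ico h0.ne] at h
      exact le_on_closure (f := fun τ => ‖x τ‖) (g := fun _ => R + 1) (fun s hs => by have := hτ s hs; linarith) hcc continuousOn_const h
    have := hb t ht x ((hx.mono ht.2).of_trunc hle)
    linarith
  exact ⟨x, hx.of_trunc fun t ht => by linarith [key t ht]⟩

lemma sqmax (x : ℝ) : HasDerivAt (fun y : ℝ => (max y 0)^2) (2 * max x 0) x := by
  have hne : ∀ y : ℝ, y ≠ 0 → HasDerivAt (fun y : ℝ => (max y 0)^2) (2 * max y 0) y := by
    intro y hy
    rcases lt_or_gt_of_ne hy with h | h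
    · rw [max_eq_right h.le, mul_zero]
      refine (hasDerivAt_const y (0:ℝ)).congr_of_eventuallyEq ?_
      filter_upwards [gt_mem_nhds h] with z hz
      simp [max_eq_right hz.le]
    · rw [max_eq_left h.le]
      have := (hasDerivAt_id y).pow 2
      simp at this
      refine this.congr_of_eventuallyEq ?_
      filter_upwards [lt_mem_nhds h] with z hz
      simp [max_eq_left hz.le]
  by_cases hx : x = 0
  · subst hx
    refine hasDerivAt_of_hasDerivAt_of_ne (g := fun y => 2 * max y 0) (fun y hy => hne y hy) ?_ ?_
    · exact Continuous.continuousAt (by fun_prop)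
    · exact Continuous.continuousAt (by fun_prop)
  · exact hne x hx

/-- the vector field -/
noncomputable def Fs (α β : ℝ) (x : PS) : PS :=
  (x.2.2.1, x.2.2.2, max x.1 0 * ((max x.2.1 0)^2 - α * (max x.1 0)^2),
    max x.2.1 0 * ((max x.1 0)^2 - β * (max x.2.1 0)^2))

lemma Fs_lip (α β : ℝ) : LipB (Fs α β) := by
  intro R
  let G : PS → PS := fun x => (x.2.2.1, x.2.2.2, x.1 * (x.2.1^2 - α * x.1^2), x.2.1 * (x.1^2 - β * x.2.1^2))
  have hG : ContDiff ℝ 1 G := by unfold G; fun_prop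
  let P : PS → PS := fun x => (max x.1 0, max x.2.1 0, x.2.2.1, x.2.2.2)
  have hP : LipschitzWith 1 P := by
    have h1 : LipschitzWith 1 (fun x : PS => x.1) := LipschitzWith.prod_fst
    have h2 : LipschitzWith 1 (fun x : PS => x.2) := LipschitzWith.prod_snd
    have h3 : LipschitzWith 1 (fun x : ℝ × ℝ × ℝ => x.1) := LipschitzWith.prod_fst
    have h4 : LipschitzWith 1 (fun x : ℝ × ℝ × ℝ => x.2) := LipschitzWith.prod_snd
    have := (h1.max_const 0).prodMk (((h3.comp h2).max_const 0).prodMk (h4.comp h2))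
    simp only [max_self, mul_one] at this
    exact this
  have hGl : LocallyLipschitz G := hG.locallyLipschitz
  obtain ⟨K, hK⟩ := hGl.locallyLipschitzOn.exists_lipschitzOnWith_of_compact (isCompact_closedBall (0:PS) R)
  refine ⟨K * 1, ?_⟩
  have := hK.comp (hP.lipschitzOnWith (s := Metric.closedBall 0 R)) ?_
  · exact this
  · intro x hx
    rw [mem_closedBall_zero_iff, PS_norm_le] at hx ⊢
    have hm : ∀ y : ℝ, |max y 0| ≤ |y| := fun y => by
      rw [abs_of_nonneg (le_max_right y 0)]; exact max_le (le_abs_self y) (abs_nonneg y)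
    exact ⟨(hm _).trans hx.1, (hm _).trans hx.2.1, hx.2.2.1, hx.2.2.2⟩

lemma mono_h {f f' : ℝ → ℝ} {a b : ℝ} (hab : a ≤ b) (h : ∀ t ∈ Set.Icc a b, HasDerivWithinAt f (f' t) (Set.Icc a b) t)
    (hn : ∀ t ∈ Set.Ioo a b, 0 ≤ f' t) : f a ≤ f b := by
  refine monotoneOn_of_hasDerivWithinAt_nonneg (D := Set.Icc a b) (f' := f') (convex_Icc a b)
    (fun t ht => (h t ht).continuousWithinAt) ?_ ?_ ⟨le_rfl, hab⟩ ⟨hab, le_rfl⟩ hab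
  · rw [interior_Icc]
    exact fun t ht => (h t ⟨ht.1.le, ht.2.le⟩).mono Set.Ioo_subset_Icc_self
  · rw [interior_Icc]; exact hn

lemma smono_h {f f' : ℝ → ℝ} {a b : ℝ} (hab : a < b) (h : ∀ t ∈ Set.Icc a b, HasDerivWithinAt f (f' t) (Set.Icc a b) t)
    (hn : ∀ t ∈ Set.Ioo a b, 0 < f' t) : f a < f b := by
  refine strictMonoOn_of_hasDerivWithinAt_pos (D := Set.Icc a b) (f' := f') (convex_Icc a b)
    (fun t ht => (h t ht).continuousWithinAt) ?_ ?_ ⟨le_rfl, hab.le⟩ ⟨hab.le, le_rfl⟩ hab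
  · rw [interior_Icc]
    exact fun t ht => (h t ⟨ht.1.le, ht.2.le⟩).mono Set.Ioo_subset_Icc_self
  · rw [interior_Icc]; exact hn

lemma const_h {f f' : ℝ → ℝ} {a b : ℝ} (hab : a ≤ b) (h : ∀ t ∈ Set.Icc a b, HasDerivWithinAt f (f' t) (Set.Icc a b) t)
    (hn : ∀ t ∈ Set.Ioo a b, f' t = 0) : f a = f b := by
  apply le_antisymm
  · exact mono_h hab h (fun t ht => (hn t ht).ge)
  · have := mono_h hab (f := fun t => - f t) (f' := fun t => - f' t) (fun t ht => (h t ht).neg) (fun t ht => by simp [hn t ht])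
    linarith

/-- potential -/
noncomputable def Vp (α β : ℝ) (x : PS) : ℝ :=
  α / 4 * ((max x.1 0)^2)^2 + β / 4 * ((max x.2.1 0)^2)^2 - 1/2 * ((max x.1 0)^2 * (max x.2.1 0)^2)
/-- energy -/
noncomputable def En (α β : ℝ) (x : PS) : ℝ := 1/2 * (x.2.2.1^2 + x.2.2.2^2) + Vp α β x
/-- radial momentum -/
noncomputable def Kf (x : PS) : ℝ := x.1 * x.2.2.1 + x.2.1 * x.2.2.2
/-- squared radius -/
noncomputable def rs (x : PS) : ℝ := x.1^2 + x.2.1^2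

section
variable {α β T : ℝ} {x : ℝ → PS} {x0 : PS}

lemma IsSol.d1 (h : IsSol (Fs α β) x T x0) : ∀ t ∈ Set.Icc 0 T,
    HasDerivWithinAt (fun t => (x t).1) (x t).2.2.1 (Set.Icc 0 T) t := fun t ht => (h.2 t ht).fst
lemma IsSol.d2 (h : IsSol (Fs α β) x T x0) : ∀ t ∈ Set.Icc 0 T,
    HasDerivWithinAt (fun t => (x t).2.1) (x t).2.2.2 (Set.Icc 0 T) t := fun t ht => (h.2 t ht).snd.fst
lemma IsSol.d3 (h : IsSol (Fs α β) x T x0) : ∀ t ∈ Set.Icc 0 T,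
    HasDerivWithinAt (fun t => (x t).2.2.1) (Fs α β (x t)).2.2.1 (Set.Icc 0 T) t := fun t ht => (h.2 t ht).snd.snd.fst
lemma IsSol.d4 (h : IsSol (Fs α β) x T x0) : ∀ t ∈ Set.Icc 0 T,
    HasDerivWithinAt (fun t => (x t).2.2.2) (Fs α β (x t)).2.2.2 (Set.Icc 0 T) t := fun t ht => (h.2 t ht).snd.snd.snd

lemma mmax (y : ℝ) : y * max y 0 = (max y 0)^2 := by
  rcases le_total y 0 with h | h
  · simp [max_eq_right h]
  · simp [max_eq_left h, sq]

lemma IsSol.dK (h : IsSol (Fs α β) x T x0) : ∀ t ∈ Set.Icc 0 T,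
    HasDerivWithinAt (fun t => Kf (x t)) ((x t).2.2.1^2 + (x t).2.2.2^2 - 4 * Vp α β (x t)) (Set.Icc 0 T) t := by
  intro t ht
  have := ((h.d1 t ht).mul (h.d3 t ht)).add ((h.d2 t ht).mul (h.d4 t ht))
  refine this.congr_deriv ?_
  have e1 := mmax (x t).1
  have e2 := mmax (x t).2.1
  simp only [Fs, Vp]
  linear_combination (max (x t).2.1 0 ^ 2 - α * max (x t).1 0 ^ 2) * e1 + (max (x t).1 0 ^ 2 - β * max (x t).2.1 0 ^ 2) * e2

lemma IsSol.dr (h : IsSol (Fs α β) x T x0) : ∀ t ∈ Set.Icc 0 T,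
    HasDerivWithinAt (fun t => rs (x t)) (2 * Kf (x t)) (Set.Icc 0 T) t := by
  intro t ht
  have := ((h.d1 t ht).pow 2).add ((h.d2 t ht).pow 2)
  refine this.congr_deriv ?_
  simp only [Kf]; push_cast; ring

lemma IsSol.dE (h : IsSol (Fs α β) x T x0) : ∀ t ∈ Set.Icc 0 T,
    HasDerivWithinAt (fun t => En α β (x t)) 0 (Set.Icc 0 T) t := by
  intro t ht
  have ha := (sqmax (x t).1).comp_hasDerivWithinAt t (h.d1 t ht)
  have hb := (sqmax (x t).2.1).comp_hasDerivWithinAt t (h.d2 t ht)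
  have := ((((h.d3 t ht).pow 2).add ((h.d4 t ht).pow 2)).const_mul (1/2)).add
    ((((ha.pow 2).const_mul (α/4)).add ((hb.pow 2).const_mul (β/4))).sub ((ha.mul hb).const_mul (1/2)))
  refine this.congr_deriv ?_
  simp only [Fs, Function.comp]; push_cast; ring

lemma IsSol.E_const (h : IsSol (Fs α β) x T x0) : ∀ t ∈ Set.Icc 0 T, En α β (x t) = En α β x0 := by
  intro t ht
  have := const_h ht.1 (f := fun t => En α β (x t)) (f' := fun _ => 0) (fun s hs => ((h.mono ht.2).dE s hs)) (fun _ _ => rfl)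
  simp only [h.1] at this
  exact this.symm

/-- trapping region -/
def Dr (α β : ℝ) : Set PS := {x | 0 < Kf x ∧ 0 < Kf x ^ 2 - 2 * En α β x * rs x}

lemma Dr_open : IsOpen (Dr α β) := by
  have h1 : Continuous (fun x : PS => Kf x) := by unfold Kf; fun_prop
  have h2 : Continuous (fun x : PS => Kf x ^ 2 - 2 * En α β x * rs x) := by unfold Kf En Vp rs; fun_prop
  exact (isOpen_lt continuous_const h1).inter (isOpen_lt continuous_const h2)

lemma Dr_V {x : PS} (hx : x ∈ Dr α β) : Vp α β x < 0 := by
  obtain ⟨h1, h2⟩ := hx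
  by_contra hc
  push Not at hc
  have hr : 0 ≤ rs x := by unfold rs; positivity
  have := mul_nonneg hc hr
  simp only [En] at h2
  have cs : Kf x ^ 2 ≤ (x.2.2.1^2 + x.2.2.2^2) * rs x := by
    simp only [Kf, rs]; nlinarith [sq_nonneg (x.1 * x.2.2.2 - x.2.1 * x.2.2.1)]
  nlinarith

lemma V_pos (hα : 0 < α) (hβ : 0 < β) {x : PS} (hx : Vp α β x < 0) : 0 < x.1 ∧ 0 < x.2.1 := by
  constructor
  · by_contra hc
    rw [Vp, max_eq_right (not_lt.1 hc)] at hx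
    have : 0 ≤ β / 4 * ((max x.2.1 0)^2)^2 := by positivity
    simp at hx; linarith
  · by_contra hc
    rw [Vp, max_eq_right (not_lt.1 hc)] at hx
    have : 0 ≤ α / 4 * ((max x.1 0)^2)^2 := by positivity
    simp at hx; linarith

lemma Dr_trap (h : IsSol (Fs α β) x T x0) {t1 : ℝ} (ht1 : t1 ∈ Set.Icc 0 T) (hD : x t1 ∈ Dr α β) :
    ∀ t ∈ Set.Icc t1 T, x t ∈ Dr α β := by
  set E0 := En α β x0 with hE0
  let Qf : ℝ → ℝ := fun t => Kf (x t) ^ 2 - 2 * E0 * rs (x t)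
  have hmem : ∀ t ∈ Set.Icc 0 T, (x t ∈ Dr α β ↔ 0 < min (Kf (x t)) (Qf t)) := by
    intro t ht
    simp only [Dr, Set.mem_ofPred_eq, lt_min_iff, Qf, h.E_const t ht]; rfl
  have hsub : ∀ {t}, t ∈ Set.Icc t1 T → t ∈ Set.Icc 0 T := fun ht => ⟨ht1.1.trans ht.1, ht.2⟩
  have dQ : ∀ t ∈ Set.Icc 0 T, HasDerivWithinAt Qf (-12 * Kf (x t) * Vp α β (x t)) (Set.Icc 0 T) t := by
    intro t ht
    have := ((h.dK t ht).pow 2).sub ((h.dr t ht).const_mul (2 * E0))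
    refine this.congr_deriv ?_
    have e := h.E_const t ht
    rw [← hE0] at e
    rw [← e]; simp only [En]; push_cast; ring
  have key := cont_ind (f := fun t => min (Kf (x t)) (Qf t)) (a := t1) (b := T) ?_ ?_
  · intro t ht
    exact (hmem t (hsub ht)).2 (key t ht)
  · intro t ht
    have c1 := (h.dK t (hsub ht)).continuousWithinAt
    have c2 := (dQ t (hsub ht)).continuousWithinAt
    exact (ContinuousWithinAt.mono (Tendsto.min c1 c2) (Set.Icc_subset_Icc_left ht1.1))
  · intro t ht hpos
    have hs : Set.Icc t1 t ⊆ Set.Icc 0 T := Set.Icc_subset_Icc ht1.1 ht.2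
    have hDτ : ∀ τ ∈ Set.Ioo t1 t, x τ ∈ Dr α β := fun τ hτ =>
      (hmem τ (hs ⟨hτ.1.le, hτ.2.le⟩)).2 (hpos τ ⟨hτ.1.le, hτ.2⟩)
    have m1 := mono_h ht.1 (f := fun t => Kf (x t)) (fun s hs' => (h.dK s (hs hs')).mono hs)
      (fun s hs' => by have := Dr_V (hDτ s hs'); nlinarith [sq_nonneg (x s).2.2.1, sq_nonneg (x s).2.2.2])
    have m2 := mono_h ht.1 (f := Qf) (fun s hs' => (dQ s (hs hs')).mono hs)
      (fun s hs' => by have := Dr_V (hDτ s hs'); have := (hDτ s hs').1; nlinarith)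
    have := (hmem t1 ht1).1 hD
    rw [lt_min_iff] at this ⊢
    exact ⟨this.1.trans_le m1, this.2.trans_le m2⟩

end

lemma neg_trap {u p g : ℝ → ℝ} {T : ℝ} (hu : ∀ t ∈ Set.Icc 0 T, HasDerivWithinAt u (p t) (Set.Icc 0 T) t)
    (hp : ∀ t ∈ Set.Icc 0 T, HasDerivWithinAt p (g t) (Set.Icc 0 T) t) (hg : ∀ t ∈ Set.Icc 0 T, u t ≤ 0 → g t = 0)
    (hp0 : p 0 = 0) {t1 : ℝ} (ht1 : t1 ∈ Set.Icc 0 T) (h1 : u t1 < 0) : u T < 0 := by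
  have hT : 0 ≤ T := ht1.1.trans ht1.2
  obtain ⟨m, hm, hmin⟩ := isCompact_Icc.exists_isMinOn ⟨t1, ht1⟩ (fun t ht => (hu t ht).continuousWithinAt : ContinuousOn u (Set.Icc 0 T))
  have hum : u m < 0 := lt_of_le_of_lt (hmin ht1) h1
  rcases eq_or_lt_of_le hm.2 with hmT | hmT
  · rw [← hmT]; exact hum
  have hpm : p m = 0 := by
    rcases eq_or_lt_of_le hm.1 with h0 | h0
    · rw [← h0]; exact hp0
    · have hn : Set.Icc 0 T ∈ 𝓝 m := Icc_mem_nhds h0 hmT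
      exact (hmin.isLocalMin hn).hasDerivAt_eq_zero ((hu m hm).hasDerivAt hn)
  have key := cont_ind (f := fun t => - u t) (a := m) (b := T) ?_ ?_
  · have := key T ⟨hm.2, le_rfl⟩
    linarith
  · intro t ht
    exact ((hu t ⟨hm.1.trans ht.1, ht.2⟩).continuousWithinAt.mono (Set.Icc_subset_Icc_left hm.1)).neg
  · intro t ht hpos
    have hs : Set.Icc m t ⊆ Set.Icc 0 T := Set.Icc_subset_Icc hm.1 ht.2
    have pz : ∀ s ∈ Set.Icc m t, p s = 0 := by
      intro s hs'
      have hs2 : Set.Icc m s ⊆ Set.Icc 0 T := (Set.Icc_subset_Icc_right hs'.2).trans hs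
      have := const_h hs'.1 (f := p) (fun r hr => (hp r (hs2 hr)).mono hs2)
        (fun r hr => hg r (hs2 ⟨hr.1.le, hr.2.le⟩) (by have := hpos r ⟨hr.1.le, hr.2.trans_le hs'.2⟩; linarith))
      rw [← this, hpm]
    have := const_h ht.1 (f := u) (fun r hr => (hu r (hs hr)).mono hs) (fun r hr => pz r ⟨hr.1.le, hr.2.le⟩)
    rw [← this]; linarith

lemma hit_open {F : PS → PS} (hF : LipB F) {W : Set PS} (hW : IsOpen W) :
    IsOpen {s : ℝ | ∃ T, 0 ≤ T ∧ ∃ x, IsSol F x T (1, s, 0, 0) ∧ x T ∈ W} := by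
  rw [Metric.isOpen_iff]
  rintro s ⟨T, hT, x, hx, hxW⟩
  obtain ⟨e, he, hb⟩ := Metric.isOpen_iff.1 hW _ hxW
  obtain ⟨δ, hδ, hd⟩ := sol_stab hF hT hx he
  refine ⟨δ, hδ, fun s' hs' => ?_⟩
  obtain ⟨y, hy, hyd⟩ := hd (1, s', 0, 0) (by
    rw [Metric.mem_ball] at hs'
    simp only [Prod.dist_eq, dist_self]
    simp [hs'])
  exact ⟨T, hT, y, hy, hb (hyd T ⟨hT, le_rfl⟩)⟩

lemma Ebound {α β : ℝ} (hα : 0 < α) (hβ : 0 < β) (x : PS) {Y : ℝ} (hY : rs x ≤ Y) {c : ℝ} (hc : |En α β x| ≤ c) :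
    ‖x‖ ≤ 1 + 2 * c + Y + Y^2 := by
  have hab : (max x.1 0)^2 * (max x.2.1 0)^2 ≤ Y^2 := by
    have h1 : (max x.1 0)^2 ≤ x.1^2 := by
      rcases le_total x.1 0 with h | h
      · rw [max_eq_right h]; nlinarith [sq_nonneg x.1]
      · rw [max_eq_left h]
    have h2 : (max x.2.1 0)^2 ≤ x.2.1^2 := by
      rcases le_total x.2.1 0 with h | h
      · rw [max_eq_right h]; nlinarith [sq_nonneg x.2.1]
      · rw [max_eq_left h]
    unfold rs at hY
    have h3 : (max x.1 0)^2 ≤ Y := by nlinarith [sq_nonneg x.2.1]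
    have h4 : (max x.2.1 0)^2 ≤ Y := by nlinarith [sq_nonneg x.1]
    rw [sq Y]
    exact mul_le_mul h3 h4 (by positivity) (by nlinarith [sq_nonneg x.1, sq_nonneg x.2.1])
  have hV : -(1/2) * Y^2 ≤ Vp α β x := by
    unfold Vp
    have : 0 ≤ α / 4 * ((max x.1 0)^2)^2 := by positivity
    have : 0 ≤ β / 4 * ((max x.2.1 0)^2)^2 := by positivity
    linarith
  have hE : 1/2 * (x.2.2.1^2 + x.2.2.2^2) + Vp α β x ≤ c := (le_abs_self _).trans hc
  have hc0 := (abs_nonneg _).trans hc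
  have hab1 : ∀ y : ℝ, |y| ≤ 1 + y^2 := fun y => by
    rw [abs_le]; constructor <;> nlinarith [sq_nonneg (y-1), sq_nonneg (y+1)]
  unfold rs at hY
  rw [PS_norm_le]
  have := sq_nonneg Y
  have := sq_nonneg x.1
  have := sq_nonneg x.2.1
  have := sq_nonneg x.2.2.1
  have := sq_nonneg x.2.2.2
  refine ⟨(hab1 _).trans ?_, (hab1 _).trans ?_, (hab1 _).trans ?_, (hab1 _).trans ?_⟩ <;> linarith

lemma grow {α β T : ℝ} {x : ℝ → PS} {x0 : PS} (hT : 0 ≤ T) (h : IsSol (Fs α β) x T x0)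
    (hD : ∀ t ∈ Set.Icc 0 T, x t ∉ Dr α β) : rs (x T) ≤ (1 + rs x0) * Real.exp ((1 + 2 * |En α β x0|) * T) := by
  set c := 1 + 2 * |En α β x0| with hc
  have hd : ∀ t ∈ Set.Icc 0 T, HasDerivWithinAt (fun t => -((1 + rs (x t)) * Real.exp (-c * t)))
      ((c * (1 + rs (x t)) - 2 * Kf (x t)) * Real.exp (-c*t)) (Set.Icc 0 T) t := by
    intro t ht
    have e : HasDerivWithinAt (fun t : ℝ => Real.exp (-c * t)) (Real.exp (-c*t) * (-c)) (Set.Icc 0 T) t := by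
      have := ((hasDerivAt_id t).const_mul (-c)).exp
      simp only [id, mul_one] at this
      exact this.hasDerivWithinAt
    have := (((h.dr t ht).const_add 1).mul e).neg
    refine this.congr_deriv ?_
    ring
  have := mono_h hT hd (fun t ht => by
    refine mul_nonneg ?_ (Real.exp_pos _).le
    have ht' : t ∈ Set.Icc 0 T := ⟨ht.1.le, ht.2.le⟩
    have hn := hD t ht'
    have hr : 0 ≤ rs (x t) := by unfold rs; positivity
    have ha := abs_nonneg (En α β x0)
    by_cases hK : 0 < Kf (x t)
    · have : ¬ (0 < Kf (x t) ^ 2 - 2 * En α β (x t) * rs (x t)) := fun hq => hn ⟨hK, hq⟩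
      rw [h.E_const t ht'] at this
      have h2 := mul_le_mul_of_nonneg_right (le_abs_self (En α β x0)) hr
      nlinarith [sq_nonneg (Kf (x t) - 1)]
    · nlinarith [mul_nonneg ha hr])
  simp only [h.1, mul_zero, Real.exp_zero, mul_one] at this
  have e2 : Real.exp (-c * T) * Real.exp (c * T) = 1 := by rw [← Real.exp_add]; simp
  have hp := Real.exp_pos (c*T)
  have : (1 + rs (x T)) * Real.exp (-c * T) * Real.exp (c * T) ≤ (1 + rs x0) * Real.exp (c * T) :=
    mul_le_mul_of_nonneg_right (by linarith) hp.le
  rw [mul_assoc, e2] at this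
  linarith

/-- negative set -/
def Ng : Set PS := {x | x.1 < 0 ∨ x.2.1 < 0}

lemma Ng_open : IsOpen Ng := by
  have h1 : Continuous (fun x : PS => x.1) := by fun_prop
  have h2 : Continuous (fun x : PS => x.2.1) := by fun_prop
  exact (isOpen_lt h1 continuous_const).union (isOpen_lt h2 continuous_const)

lemma Ng_trap {α β T s : ℝ} {x : ℝ → PS} (h : IsSol (Fs α β) x T (1, s, 0, 0)) {t1 : ℝ}
    (ht1 : t1 ∈ Set.Icc 0 T) (hN : x t1 ∈ Ng) : x T ∈ Ng := by
  rcases hN with hN | hN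
  · left
    exact neg_trap h.d1 h.d3 (fun t _ hu => by simp [Fs, max_eq_right hu]) (by simp [h.1]) ht1 hN
  · right
    exact neg_trap h.d2 h.d4 (fun t _ hu => by simp [Fs, max_eq_right hu]) (by simp [h.1]) ht1 hN

lemma Ng_Dr {α β : ℝ} (hα : 0 < α) (hβ : 0 < β) {x : PS} (h1 : x ∈ Ng) (h2 : x ∈ Dr α β) : False := by
  have := V_pos hα hβ (Dr_V h2)
  rcases h1 with h | h <;> linarith [this.1, this.2]

lemma shoot {α β : ℝ} (hα : 0 < α) (hβ : 0 < β) (hab : α * β < 1) : ∃ s : ℝ,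
    ∀ T, 0 ≤ T → ∀ x, IsSol (Fs α β) x T (1, s, 0, 0) → x T ∉ Ng ∧ x T ∉ Dr α β := by
  have hF := Fs_lip α β
  have oA := hit_open hF Ng_open
  have oB := hit_open hF (Dr_open (α := α) (β := β))
  set A := {s : ℝ | ∃ T, 0 ≤ T ∧ ∃ x, IsSol (Fs α β) x T (1, s, 0, 0) ∧ x T ∈ Ng} with hA
  set B := {s : ℝ | ∃ T, 0 ≤ T ∧ ∃ x, IsSol (Fs α β) x T (1, s, 0, 0) ∧ x T ∈ Dr α β} with hB
  by_contra hcon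
  push Not at hcon
  have hcov : ∀ s, s ∈ A ∪ B := by
    intro s
    obtain ⟨T, hT, x, hx, h⟩ := hcon s
    by_cases hn : x T ∈ Ng
    · exact Or.inl ⟨T, hT, x, hx, hn⟩
    · exact Or.inr ⟨T, hT, x, hx, h hn⟩
  have hdisj : ∀ s, s ∈ A → s ∈ B → False := by
    rintro s ⟨T, hT, x, hx, hxN⟩ ⟨S, hS, y, hy, hyD⟩
    rcases le_total T S with hTS | hTS
    · have e := sol_unique hF hx (hy.mono hTS) T ⟨hT, le_rfl⟩
      rw [e] at hxN
      exact Ng_Dr hα hβ (Ng_trap hy ⟨hT, hTS⟩ hxN) hyD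
    · have e := sol_unique hF (hx.mono hTS) hy S ⟨hS, le_rfl⟩
      rw [← e] at hyD
      exact Ng_Dr hα hβ hxN (Dr_trap hx ⟨hS, hTS⟩ hyD T ⟨hTS, le_rfl⟩)
  have hmA : (-1 : ℝ) ∈ A := by
    refine ⟨0, le_rfl, fun _ => (1, -1, 0, 0), ⟨rfl, fun t ht => ?_⟩, Or.inr (by norm_num)⟩
    rw [Set.Icc_self] at ht ⊢
    rw [Set.mem_singleton_iff.1 ht]
    exact (HasFDerivWithinAt.of_subsingleton Set.subsingleton_singleton)
  have hs1 : (1 / √β) ∈ B := by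
    rcases hcov (1/√β) with h | h
    swap
    · exact h
    exfalso
    obtain ⟨T, hT, x, hx, hxN⟩ := h
    have hsp : 0 < 1 / √β := by positivity
    have hE : En α β (1, 1/√β, 0, 0) < 0 := by
      simp only [En, Vp, max_eq_left hsp.le]
      have : (1/√β)^2 = 1/β := by rw [div_pow, Real.sq_sqrt hβ.le]; simp
      rw [this]
      have e : α / 4 * ((max (1:ℝ) 0) ^ 2) ^ 2 + β / 4 * (1/β)^2 - 1/2 * ((max (1:ℝ) 0)^2 * (1/β)) = (α * β - 1) / (4 * β) := by
        rw [max_eq_left (zero_le_one)]; field_simp; ring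
      rw [e]
      have : (α * β - 1) / (4 * β) < 0 := div_neg_of_neg_of_pos (by linarith) (by linarith)
      simpa using this
    rcases eq_or_lt_of_le hT with h0 | h0
    · rw [← h0, hx.1] at hxN
      rcases hxN with h | h
      · norm_num at h
      · simp only at h; linarith
    have hK := smono_h h0 hx.dK (fun t ht => by
      have := hx.E_const t ⟨ht.1.le, ht.2.le⟩
      have h2 : En α β (x t) < 0 := by rw [this]; exact hE
      simp only [En] at h2
      nlinarith [sq_nonneg (x t).2.2.1, sq_nonneg (x t).2.2.2])
    have hK0 : Kf (x 0) = 0 := by rw [hx.1]; simp [Kf]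
    simp only [hK0] at hK
    refine Ng_Dr hα hβ hxN ⟨hK, ?_⟩
    rw [hx.E_const T ⟨hT, le_rfl⟩]
    have hr : 0 ≤ rs (x T) := by unfold rs; positivity
    nlinarith [mul_nonneg (neg_nonneg.2 hE.le) hr, pow_pos hK 2]
  obtain ⟨s, -, hsA, hsB⟩ := (isPreconnected_univ (α := ℝ)) A B oA oB (fun s _ => hcov s) ⟨_, trivial, hmA⟩ ⟨_, trivial, hs1⟩
  exact hdisj s hsA hsB

lemma half_line {α β : ℝ} (hα : 0 < α) (hβ : 0 < β) (hab : α * β < 1) : ∃ (s : ℝ) (x : ℝ → PS), x 0 = (1, s, 0, 0) ∧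
    (∀ t, 0 ≤ t → HasDerivWithinAt x (Fs α β (x t)) (Set.Ici 0) t) ∧ ∀ t, 0 ≤ t → 0 ≤ (x t).1 ∧ 0 ≤ (x t).2.1 := by
  have hF := Fs_lip α β
  obtain ⟨s, hs⟩ := shoot hα hβ hab
  set x0 : PS := (1, s, 0, 0) with hx0
  have hex : ∀ n : ℕ, ∃ x, IsSol (Fs α β) x n x0 := by
    intro n
    set Y := (1 + rs x0) * Real.exp ((1 + 2 * |En α β x0|) * n) with hY
    have hb : ∀ T' ∈ Set.Icc 0 (n:ℝ), ∀ x, IsSol (Fs α β) x T' x0 → ‖x T'‖ ≤ 1 + 2 * |En α β x0| + Y + Y^2 := by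
      intro T hT x hx
      refine Ebound hα hβ _ ?_ (by rw [hx.E_const T ⟨hT.1, le_rfl⟩])
      refine (grow hT.1 hx (fun t ht => (hs t ht.1 x (hx.mono ht.2)).2)).trans ?_
      have hr : 0 ≤ rs x0 := by unfold rs; positivity
      rw [hY]
      gcongr
      exact hT.2
    have hr : 0 ≤ rs x0 := by unfold rs; positivity
    refine sol_exists hF n.cast_nonneg (R := 1 + 2 * |En α β x0| + Y + Y^2) (by positivity) hb ?_
    refine Ebound hα hβ _ ?_ le_rfl
    have : 1 ≤ Real.exp ((1 + 2 * |En α β x0|) * n) := Real.one_le_exp (by positivity)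
    nlinarith
  choose X hX using hex
  let x : ℝ → PS := fun t => X (⌈t⌉₊) t
  have hag : ∀ n : ℕ, ∀ t ∈ Set.Icc 0 (n:ℝ), x t = X n t := by
    intro n t ht
    exact sol_unique hF ((hX ⌈t⌉₊).mono (Nat.le_ceil t)) ((hX n).mono ht.2) t ⟨ht.1, le_rfl⟩
  refine ⟨s, x, ?_, ?_, ?_⟩
  · rw [hag 0 0 (by simp)]; exact (hX 0).1
  · intro t ht
    obtain ⟨n, hn⟩ := exists_nat_gt t
    have h1 := (hX n).2 t ⟨ht, hn.le⟩
    have h2 : HasDerivWithinAt x (Fs α β (x t)) (Set.Icc 0 n) t := by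
      rw [hag n t ⟨ht, hn.le⟩]
      exact h1.congr (fun y hy => hag n y hy) (hag n t ⟨ht, hn.le⟩)
    refine h2.mono_of_mem_nhdsWithin ?_
    rw [← Set.Ici_inter_Iic]
    exact inter_mem self_mem_nhdsWithin (mem_nhdsWithin_of_mem_nhds (Iic_mem_nhds hn))
  · intro t ht
    have := (hs t ht x ?_).1
    · simp only [Ng, Set.mem_ofPred_eq, not_or, not_lt] at this
      exact this
    · have h3 := (hX ⌈t⌉₊).mono (Nat.le_ceil t)
      have hsub : ∀ y ∈ Set.Icc 0 t, x y = X ⌈t⌉₊ y := fun y hy => hag _ y ⟨hy.1, hy.2.trans (Nat.le_ceil t)⟩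
      refine ⟨by rw [hsub 0 ⟨le_rfl, ht⟩]; exact h3.1, fun τ hτ => ?_⟩
      rw [hsub τ hτ]
      exact (h3.2 τ hτ).congr hsub (hsub τ hτ)

lemma glue_h {g h g' h' : ℝ → ℝ} (hg : ∀ t, 0 ≤ t → HasDerivWithinAt g (g' t) (Set.Ici 0) t)
    (hh : ∀ t, t ≤ 0 → HasDerivWithinAt h (h' t) (Set.Iic 0) t) (h0 : g 0 = h 0) (h0' : g' 0 = h' 0) (t : ℝ) :
    HasDerivAt (fun t => if 0 ≤ t then g t else h t) (if 0 ≤ t then g' t else h' t) t := by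
  have e2 : ∀ y ∈ Set.Iic (0:ℝ), (if 0 ≤ y then g y else h y) = h y := by
    intro y hy
    split_ifs with hc
    · rw [le_antisymm hy hc, h0]
    · rfl
  have e2' : ∀ y ∈ Set.Iic (0:ℝ), (if 0 ≤ y then g' y else h' y) = h' y := by
    intro y hy
    split_ifs with hc
    · rw [le_antisymm hy hc, h0']
    · rfl
  have e1 : ∀ y ∈ Set.Ici (0:ℝ), (if 0 ≤ y then g y else h y) = g y := fun y hy => if_pos hy
  have e1' : ∀ y ∈ Set.Ici (0:ℝ), (if 0 ≤ y then g' y else h' y) = g' y := fun y hy => if_pos hy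
  have d1 : ∀ t, 0 ≤ t → HasDerivWithinAt (fun t => if 0 ≤ t then g t else h t) (if 0 ≤ t then g' t else h' t) (Set.Ici 0) t :=
    fun t ht => by rw [e1' t ht]; exact (hg t ht).congr e1 (e1 t ht)
  have d2 : ∀ t, t ≤ 0 → HasDerivWithinAt (fun t => if 0 ≤ t then g t else h t) (if 0 ≤ t then g' t else h' t) (Set.Iic 0) t :=
    fun t ht => by rw [e2' t ht]; exact (hh t ht).congr e2 (e2 t ht)
  rcases lt_trichotomy t 0 with ht | ht | ht
  · exact (d2 t ht.le).hasDerivAt (Iic_mem_nhds ht)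
  · subst ht
    have := (d1 0 le_rfl).union (d2 0 le_rfl)
    rw [Set.union_comm, Set.Iic_union_Ici, hasDerivWithinAt_univ] at this
    exact this
  · exact (d1 t ht.le).hasDerivAt (Ici_mem_nhds ht)

lemma refl_h {g g' : ℝ → ℝ} (hg : ∀ t, 0 ≤ t → HasDerivWithinAt g (g' t) (Set.Ici 0) t) :
    ∀ t, t ≤ 0 → HasDerivWithinAt (fun t => g (-t)) (- g' (-t)) (Set.Iic 0) t := by
  intro t ht
  have := (hg (-t) (by linarith)).comp t ((hasDerivAt_neg t).hasDerivWithinAt (s := Set.Iic 0))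
    (fun y hy => by simp only [Set.mem_Iic] at hy; simp [hy])
  refine this.congr_deriv (by ring)

lemma ode_sol {α β : ℝ} (hα : 0 < α) (hβ : 0 < β) (hab : α * β ≤ 1) : ∃ U V P Q : ℝ → ℝ,
    (∀ t, 0 ≤ U t) ∧ (∀ t, 0 ≤ V t) ∧ (∀ t, HasDerivAt U (P t) t) ∧ (∀ t, HasDerivAt V (Q t) t) ∧
    (∀ t, HasDerivAt P (U t * (V t ^ 2 - α * U t ^ 2)) t) ∧ (∀ t, HasDerivAt Q (V t * (U t ^ 2 - β * V t ^ 2)) t) ∧ U 0 = 1 := by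
  rcases eq_or_lt_of_le hab with h1 | h1
  · refine ⟨fun _ => 1, fun _ => √α, fun _ => 0, fun _ => 0, fun _ => zero_le_one, fun _ => Real.sqrt_nonneg α,
      fun t => hasDerivAt_const t _, fun t => hasDerivAt_const t _, fun t => ?_, fun t => ?_, rfl⟩
    · rw [Real.sq_sqrt hα.le]; simpa using hasDerivAt_const t (0:ℝ)
    · rw [Real.sq_sqrt hα.le, mul_comm β, h1]; simpa using hasDerivAt_const t (0:ℝ)
  obtain ⟨s, x, hx0, hx, hpos⟩ := half_line hα hβ h1
  have d1 : ∀ t, 0 ≤ t → HasDerivWithinAt (fun t => (x t).1) (x t).2.2.1 (Set.Ici 0) t := fun t ht => (hx t ht).fst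
  have d2 : ∀ t, 0 ≤ t → HasDerivWithinAt (fun t => (x t).2.1) (x t).2.2.2 (Set.Ici 0) t := fun t ht => (hx t ht).snd.fst
  have d3 : ∀ t, 0 ≤ t → HasDerivWithinAt (fun t => (x t).2.2.1) (Fs α β (x t)).2.2.1 (Set.Ici 0) t := fun t ht => (hx t ht).snd.snd.fst
  have d4 : ∀ t, 0 ≤ t → HasDerivWithinAt (fun t => (x t).2.2.2) (Fs α β (x t)).2.2.2 (Set.Ici 0) t := fun t ht => (hx t ht).snd.snd.snd
  refine ⟨_, _, _, _, ?_, ?_, glue_h d1 (refl_h d1) (by simp) (by simp [hx0]), glue_h d2 (refl_h d2) (by simp) (by simp [hx0]),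
    fun t => (glue_h d3 (fun t ht => (refl_h d3 t ht).neg) (by simp [hx0]) (by simp) t).congr_deriv ?_,
    fun t => (glue_h d4 (fun t ht => (refl_h d4 t ht).neg) (by simp [hx0]) (by simp) t).congr_deriv ?_, by simp [hx0]⟩
  · intro t
    split_ifs with h
    · exact (hpos t h).1
    · exact (hpos (-t) (by linarith)).1
  · intro t
    split_ifs with h
    · exact (hpos t h).2
    · exact (hpos (-t) (by linarith)).2
  · split_ifs with h
    · have := hpos t h
      simp only [Fs, max_eq_left this.1, max_eq_left this.2]
    · have := hpos (-t) (by linarith)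
      simp only [Fs, max_eq_left this.1, max_eq_left this.2, neg_neg]
  · split_ifs with h
    · have := hpos t h
      simp only [Fs, max_eq_left this.1, max_eq_left this.2]
    · have := hpos (-t) (by linarith)
      simp only [Fs, max_eq_left this.1, max_eq_left this.2, neg_neg]

lemma lap_lin {N : ℕ} {f g : (Fin N → ℝ) → ℝ} (hf : ContDiff ℝ 2 f) (hg : ContDiff ℝ 2 g) (a b : ℝ) (x : Fin N → ℝ) :
    laplacian (fun x => a * f x + b * g x) x = a * laplacian f x + b * laplacian g x := by
  unfold laplacian
  rw [Finset.mul_sum, Finset.mul_sum, ← Finset.sum_add_distrib]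
  refine Finset.sum_congr rfl fun i _ => ?_
  have hf1 : Differentiable ℝ f := hf.differentiable (by norm_num)
  have hg1 : Differentiable ℝ g := hg.differentiable (by norm_num)
  have e : (fun y => fderiv ℝ (fun x => a * f x + b * g x) y (Pi.single i 1)) =
      fun y => a * fderiv ℝ f y (Pi.single i 1) + b * fderiv ℝ g y (Pi.single i 1) := by
    funext y
    have := (((hf1 y).hasFDerivAt.const_mul a).add ((hg1 y).hasFDerivAt.const_mul b)).fderiv
    have e2 : (fun x => a * f x + b * g x) = ((fun y => a * f y) + fun y => b * g y) := rfl
    rw [e2, this]; simp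
  have df : ∀ {f : (Fin N → ℝ) → ℝ}, ContDiff ℝ 2 f → Differentiable ℝ (fun y => fderiv ℝ f y (Pi.single i 1)) := by
    intro f hf
    have := (hf.fderiv_right (m := 1) (by norm_num)).differentiable (by norm_num)
    exact fun y => (this y).clm_apply (differentiableAt_const _)
  rw [e]
  have := (((df hf x).hasFDerivAt.const_mul a).add ((df hg x).hasFDerivAt.const_mul b)).fderiv
  have e2 : (fun y => a * fderiv ℝ f y (Pi.single i 1) + b * fderiv ℝ g y (Pi.single i 1)) =
    ((fun y => a * fderiv ℝ f y (Pi.single i 1)) + fun y => b * fderiv ℝ g y (Pi.single i 1)) := rfl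
  rw [e2, this]; simp

lemma lap_one {N : ℕ} (i0 : Fin N) {U P W : ℝ → ℝ} (hU : ∀ t, HasDerivAt U (P t) t) (hP : ∀ t, HasDerivAt P (W t) t)
    (k : ℝ) (x : Fin N → ℝ) : laplacian (fun x => k * U (x i0)) x = k * W (x i0) := by
  have key : ∀ {U P : ℝ → ℝ} (hU : ∀ t, HasDerivAt U (P t) t) (k : ℝ) (y : Fin N → ℝ) (i : Fin N),
      fderiv ℝ (fun x : Fin N → ℝ => k * U (x i0)) y (Pi.single i 1) = (if i = i0 then k else 0) * P (y i0) := by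
    intro U P hU k y i
    have hpr : HasFDerivAt (fun x : Fin N → ℝ => x i0) (ContinuousLinearMap.proj (R := ℝ) i0) y :=
      (ContinuousLinearMap.proj (R := ℝ) (φ := fun _ : Fin N => ℝ) i0).hasFDerivAt
    have := ((hU (y i0)).comp_hasFDerivAt y hpr).const_mul k
    have e := this.fderiv
    simp only [Function.comp_def] at e
    rw [e]
    simp only [_root_.smul_apply, ContinuousLinearMap.proj_apply, smul_eq_mul, Pi.single_apply, eq_comm (a := i0)]
    split_ifs <;> ring
  unfold laplacian
  rw [Finset.sum_eq_single i0]
  · have e : (fun y : Fin N → ℝ => fderiv ℝ (fun x : Fin N → ℝ => k * U (x i0)) y (Pi.single i0 1)) = fun y => k * P (y i0) := by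
      funext y; rw [key hU]; simp
    rw [e, key hP]; simp
  · intro i _ hi
    have e : (fun y : Fin N → ℝ => fderiv ℝ (fun x : Fin N → ℝ => k * U (x i0)) y (Pi.single i 1)) = fun y => 0 := by
      funext y; rw [key hU]; simp [hi]
    rw [e]; simp
  · simp

lemma cd_one {N : ℕ} (i0 : Fin N) {U P W : ℝ → ℝ} (hU : ∀ t, HasDerivAt U (P t) t) (hP : ∀ t, HasDerivAt P (W t) t)
    (hW : Continuous W) (k : ℝ) : ContDiff ℝ 2 (fun x : Fin N → ℝ => k * U (x i0)) := by
  have e1 : deriv U = P := funext fun t => (hU t).deriv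
  have e2 : deriv P = W := funext fun t => (hP t).deriv
  have c1 : ContDiff ℝ 1 P := by
    rw [contDiff_one_iff_deriv]
    exact ⟨fun t => (hP t).differentiableAt, by rw [e2]; exact hW⟩
  have c2 : ContDiff ℝ 2 U := by
    rw [show (2 : WithTop ℕ∞) = 1 + 1 by norm_num, contDiff_succ_iff_deriv]
    exact ⟨fun t => (hU t).differentiableAt, by simp, by rw [e1]; exact c1⟩
  exact contDiff_const.mul (c2.comp (contDiff_apply ℝ ℝ i0))

lemma const_sol {N : ℕ} (k : ℝ) (x : Fin N → ℝ) : laplacian (fun _ => k) x = 0 := by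
  simp [laplacian]

lemma liou {N : ℕ} (hN : N ≤ 3)
    (B : Matrix (Fin 2) (Fin 2) ℝ) (hsym : B.IsSymm) (u : Fin 2 → (Fin N → ℝ) → ℝ)
    (hu : ∀ i, ContDiff ℝ 2 (u i)) (h0 : ∀ i x, 0 ≤ u i x)
    (he : ∀ i x, -laplacian (u i) x = ∑ j, B i j * (u j x) ^ 2 * u i x)
    (hB : 0 < B 0 0 ∧ 0 < B 1 1 ∧ -Real.sqrt (B 0 0 * B 1 1) < B 0 1) : ∀ i, u i = 0 := by
  obtain ⟨l1, l2, c, hl1, hl2, hc, hal⟩ := lv_alg (B 0 0) (B 0 1) (B 1 1) hB.1 hB.2.1 hB.2.2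
  have hs : B 1 0 = B 0 1 := hsym.apply 0 1
  have := lv_main hN (fun x => l1 * u 0 x + l2 * u 1 x) ((contDiff_const.mul (hu 0)).add (contDiff_const.mul (hu 1)))
    (fun x => add_nonneg (mul_nonneg hl1.le (h0 0 x)) (mul_nonneg hl2.le (h0 1 x))) c hc (fun x => by
      rw [lap_lin (hu 0) (hu 1)]
      have e0 := he 0 x
      have e1 := he 1 x
      rw [Fin.sum_univ_two] at e0 e1
      rw [hs] at e1
      have := hal (u 0 x) (u 1 x) (h0 0 x) (h0 1 x)
      refine this.trans (le_of_eq ?_)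
      linear_combination (-l1) * e0 - l2 * e1)
  intro i
  funext x
  have hx := this x
  have a0 := mul_nonneg hl1.le (h0 0 x)
  have a1 := mul_nonneg hl2.le (h0 1 x)
  have z0 : l1 * u 0 x = 0 := by linarith
  have z1 : l2 * u 1 x = 0 := by linarith
  fin_cases i
  · simpa [hl1.ne'] using z0
  · simpa [hl2.ne'] using z1

theorem stmt_4 (N : ℕ) (hN1 : 1 ≤ N) (hN : N ≤ 3)
    (B : Matrix (Fin 2) (Fin 2) ℝ) (hsym : B.IsSymm)
    (hdiag : 0 ≤ B 0 0 ∧ 0 ≤ B 1 1) :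
    (∃ u : Fin 2 → (Fin N → ℝ) → ℝ,
      (∀ i, ContDiff ℝ 2 (u i)) ∧
      (∀ i x, 0 ≤ u i x) ∧
      (∀ i x, -laplacian (u i) x = ∑ j, B i j * (u j x) ^ 2 * u i x) ∧
      (∃ i, u i ≠ 0)) ↔
    ¬ (0 < B 0 0 ∧ 0 < B 1 1 ∧ -Real.sqrt (B 0 0 * B 1 1) < B 0 1) := by
  have hs : B 1 0 = B 0 1 := hsym.apply 0 1
  constructor
  · rintro ⟨u, hu, h0, he, i, hi⟩ hB
    exact hi (liou hN B hsym u hu h0 he hB i)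
  intro hB
  rcases eq_or_lt_of_le hdiag.1 with ha | ha
  · refine ⟨![fun _ => 1, fun _ => 0], ?_, ?_, ?_, 0, ?_⟩
    · intro i; fin_cases i <;> exact contDiff_const
    · intro i x; fin_cases i <;> simp
    · intro i x; fin_cases i <;> simp [Fin.sum_univ_two, const_sol, ← ha]
    · intro h; have := congrFun h 0; simp at this
  rcases eq_or_lt_of_le hdiag.2 with hd | hd
  · refine ⟨![fun _ => 0, fun _ => 1], ?_, ?_, ?_, 1, ?_⟩
    · intro i; fin_cases i <;> exact contDiff_const
    · intro i x; fin_cases i <;> simp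
    · intro i x; fin_cases i <;> simp [Fin.sum_univ_two, const_sol, ← hd]
    · intro h; have := congrFun h 0; simp at this
  have hb : B 0 1 ≤ -Real.sqrt (B 0 0 * B 1 1) := by
    by_contra hc; exact hB ⟨ha, hd, not_le.1 hc⟩
  have hsq : 0 < Real.sqrt (B 0 0 * B 1 1) := Real.sqrt_pos.2 (mul_pos ha hd)
  set m := - B 0 1 with hm
  have hmp : 0 < m := by linarith
  have hmm : B 0 0 * B 1 1 ≤ m ^ 2 := by
    rw [← Real.sq_sqrt (mul_pos ha hd).le]
    exact pow_le_pow_left₀ hsq.le (by linarith) 2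
  obtain ⟨U, V, P, Q, hU0, hV0, dU, dV, dP, dQ, hU1⟩ := ode_sol (div_pos ha hmp) (div_pos hd hmp) (by
    rw [div_mul_div_comm, div_le_one (by positivity)]; linarith [sq m])
  have cU : Continuous U := continuous_iff_continuousAt.2 fun t => (dU t).continuousAt
  have cV : Continuous V := continuous_iff_continuousAt.2 fun t => (dV t).continuousAt
  set k := 1 / √m with hk
  have hkp : 0 < k := by positivity
  have hk2 : k ^ 2 = 1 / m := by rw [hk, div_pow, Real.sq_sqrt hmp.le]; simp
  have hb1 : B 0 1 = -m := by rw [hm]; ring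
  let i0 : Fin N := ⟨0, hN1⟩
  refine ⟨![fun x => k * U (x i0), fun x => k * V (x i0)], ?_, ?_, ?_, 0, ?_⟩
  · intro i; fin_cases i
    · exact cd_one i0 dU dP (by fun_prop) k
    · exact cd_one i0 dV dQ (by fun_prop) k
  · intro i x; fin_cases i
    · exact mul_nonneg hkp.le (hU0 _)
    · exact mul_nonneg hkp.le (hV0 _)
  · intro i x; fin_cases i
    · simp only [Fin.zero_eta, Fin.sum_univ_two, Matrix.cons_val_zero, Matrix.cons_val_one, hb1, mul_pow, hk2]
      rw [lap_one i0 dU dP]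
      field_simp
      ring
    · simp only [Fin.mk_one, Fin.sum_univ_two, Matrix.cons_val_zero, Matrix.cons_val_one, hs, hb1, mul_pow, hk2]
      rw [lap_one i0 dV dQ]
      field_simp
      ring
  · intro h
    have := congrFun h 0
    simp [hU1, hkp.ne'] at this
end

section
/- Let N ≤ 2, n ≥ 2, and let B = (β_ij) be a symmetric n×n real matrix which is strictly copositive. Then the system −Δu_i = ∑_{j=1}^n β_ij u_j² u_i (i = 1,…,n) does not admit a nontrivial solution on ℝ^N: if u₁,…,uₙ : ℝ^N → ℝ are twice continuously differentiable, nonnegative, and satisfy −Δu_i = ∑_{j=1}^n β_ij u_j² u_i on ℝ^N for every i, then u_i ≡ 0 for all i. -/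
open Finset

open Filter Topology

/-- `g` is twice differentiable at `0` with first and second derivative `a`, `b`. -/
def D2 (g : ℝ → ℝ) (a b : ℝ) : Prop :=
  ∃ g' : ℝ → ℝ, (∀ᶠ t in 𝓝 (0:ℝ), HasDerivAt g (g' t) t) ∧ g' 0 = a ∧ HasDerivAt g' b 0

theorem D2.add {f g : ℝ → ℝ} {a b c d : ℝ} (hf : D2 f a b) (hg : D2 g c d) :
    D2 (fun t => f t + g t) (a + c) (b + d) := by
  obtain ⟨f', h1, h2, h3⟩ := hf
  obtain ⟨g', k1, k2, k3⟩ := hg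
  refine ⟨fun t => f' t + g' t, ?_, by simp [h2, k2], h3.add k3⟩
  filter_upwards [h1, k1] with t x y using x.add y

theorem D2.const_mul {f : ℝ → ℝ} {a b : ℝ} (c : ℝ) (hf : D2 f a b) :
    D2 (fun t => c * f t) (c * a) (c * b) := by
  obtain ⟨f', h1, h2, h3⟩ := hf
  refine ⟨fun t => c * f' t, ?_, by simp [h2], h3.const_mul c⟩
  filter_upwards [h1] with t x using x.const_mul c

theorem D2.const (c : ℝ) : D2 (fun _ => c) 0 0 :=
  ⟨fun _ => 0, Eventually.of_forall fun t => hasDerivAt_const t c, rfl, hasDerivAt_const 0 0⟩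

theorem D2.sum {ι : Type*} (s : Finset ι) {f : ι → ℝ → ℝ} {a b : ι → ℝ}
    (hf : ∀ i ∈ s, D2 (f i) (a i) (b i)) :
    D2 (fun t => ∑ i ∈ s, f i t) (∑ i ∈ s, a i) (∑ i ∈ s, b i) := by
  classical
  induction s using Finset.induction_on with
  | empty => simpa using D2.const 0
  | insert i s hi ih =>
    simp only [Finset.sum_insert hi]
    exact (hf i (by simp)).add (ih fun j hj => hf j (by simp [hj]))

theorem D2.comp {f φ φ' : ℝ → ℝ} {a b c : ℝ} (hf : D2 f a b)
    (h : ∀ᶠ s in 𝓝 (f 0), HasDerivAt φ (φ' s) s) (h' : HasDerivAt φ' c (f 0)) :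
    D2 (fun t => φ (f t)) (φ' (f 0) * a) (c * a ^ 2 + φ' (f 0) * b) := by
  obtain ⟨f', h1, h2, h3⟩ := hf
  have h10 := h1.self_of_nhds
  refine ⟨fun t => φ' (f t) * f' t, ?_, by simp [h2], ?_⟩
  · filter_upwards [h1, h10.continuousAt.eventually h] with t x y using y.comp t x
  · have := (h'.comp 0 h10).mul h3
    rw [h2] at this
    exact this.congr_deriv (by simp only [Function.comp]; ring)

theorem D2.exp {f : ℝ → ℝ} {a b : ℝ} (hf : D2 f a b) :
    D2 (fun t => Real.exp (f t)) (Real.exp (f 0) * a)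
      (Real.exp (f 0) * a ^ 2 + Real.exp (f 0) * b) :=
  hf.comp (Eventually.of_forall fun s => Real.hasDerivAt_exp s) (Real.hasDerivAt_exp _)

theorem D2.log {f : ℝ → ℝ} {a b : ℝ} (hf : D2 f a b) (h0 : 0 < f 0) :
    D2 (fun t => Real.log (f t)) ((f 0)⁻¹ * a)
      (-((f 0) ^ 2)⁻¹ * a ^ 2 + (f 0)⁻¹ * b) := by
  refine hf.comp (φ' := fun s => s⁻¹) ?_ (hasDerivAt_inv h0.ne')
  filter_upwards [lt_mem_nhds h0] with s hs using Real.hasDerivAt_log (ne_of_gt hs)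

theorem D2.nonneg {f : ℝ → ℝ} {a b : ℝ} (hf : D2 f a b) (hm : IsLocalMin f 0) : 0 ≤ b := by
  obtain ⟨f', h1, h2, h3⟩ := hf
  by_contra! hb
  have h10 := h1.self_of_nhds
  have he : deriv f =ᶠ[𝓝 0] f' := by
    filter_upwards [h1] with t ht using ht.deriv
  have hd : deriv (deriv f) 0 = b := by rw [he.deriv_eq, h3.deriv]
  have hmax : IsLocalMax f 0 :=
    isLocalMax_of_deriv_deriv_neg (by rw [hd]; exact hb) hm.deriv_eq_zero h10.continuousAt
  have hc : f =ᶠ[𝓝 0] fun _ => f 0 := by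
    filter_upwards [hm, hmax] with t x y using le_antisymm y x
  have : deriv (deriv f) 0 = 0 := by
    rw [hc.deriv.deriv_eq]; simp
  linarith

theorem D2_line {N : ℕ} {f : (Fin N → ℝ) → ℝ} (hf : ContDiff ℝ 2 f) (x e : Fin N → ℝ) :
    D2 (fun t : ℝ => f (x + t • e)) (fderiv ℝ f x e)
      (fderiv ℝ (fun y => fderiv ℝ f y e) x e) := by
  have hl : ∀ t : ℝ, HasDerivAt (fun t : ℝ => x + t • e) e t := fun t => by
    simpa using ((hasDerivAt_id t).smul_const e).const_add x
  refine ⟨fun t => fderiv ℝ f (x + t • e) e, Eventually.of_forall fun t => ?_, by simp, ?_⟩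
  · exact ((hf.differentiable (by norm_num)) _).hasFDerivAt.comp_hasDerivAt t (hl t)
  · have hd : Differentiable ℝ (fun y => fderiv ℝ f y e) := by
      have : ContDiff ℝ 1 (fderiv ℝ f) := hf.fderiv_right (by norm_num)
      exact (this.differentiable (by norm_num)).clm_apply (differentiable_const e)
    have h := (hd (x + (0:ℝ) • e)).hasFDerivAt.comp_hasDerivAt (0:ℝ) (hl 0)
    simpa [Function.comp_def] using h

/-- squared Euclidean distance -/
def qq {N : ℕ} (y x : Fin N → ℝ) : ℝ := ∑ i, (x i - y i) ^ 2

theorem qq_cont {N : ℕ} (y : Fin N → ℝ) : Continuous (qq y) := by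
  unfold qq; fun_prop

theorem qq_compact {N : ℕ} (y : Fin N → ℝ) (R : ℝ) : IsCompact {x | qq y x ≤ R} := by
  refine Metric.isCompact_of_isClosed_isBounded
    (isClosed_le (qq_cont y) continuous_const) ?_
  refine (Metric.isBounded_closedBall (x := y) (r := 1 + |R|)).subset fun x hx => ?_
  rw [Metric.mem_closedBall, dist_pi_le_iff (by positivity)]
  intro i
  have h1 : (x i - y i) ^ 2 ≤ qq y x :=
    Finset.single_le_sum (f := fun i => (x i - y i) ^ 2) (fun j _ => sq_nonneg _) (mem_univ i)
  have h2 : qq y x ≤ R := hx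
  rw [Real.dist_eq]
  refine abs_le_of_sq_le_sq ?_ (by positivity)
  nlinarith [le_abs_self R, abs_nonneg R]

theorem qq_line {N : ℕ} (y x : Fin N → ℝ) (i : Fin N) :
    D2 (fun t : ℝ => qq y (x + t • Pi.single i 1)) (2 * (x i - y i)) 2 := by
  have : (fun t : ℝ => qq y (x + t • Pi.single i 1)) =
      fun t => qq y x + (2 * (x i - y i) * t + t ^ 2) := by
    funext t
    unfold qq
    rw [← Finset.add_sum_erase _ _ (mem_univ i), ← Finset.add_sum_erase univ (fun i => (x i - y i) ^ 2) (mem_univ i)]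
    have : ∑ j ∈ univ.erase i, ((x + t • (Pi.single i 1 : Fin N → ℝ)) j - y j) ^ 2
        = ∑ j ∈ univ.erase i, (x j - y j) ^ 2 := by
      refine Finset.sum_congr rfl fun j hj => ?_
      simp [Pi.single_apply, (Finset.mem_erase.1 hj).1]
    rw [this]; simp; ring
  rw [this]
  refine ⟨fun t => 2 * (x i - y i) + 2 * t, Eventually.of_forall fun t => ?_, by simp, ?_⟩
  · have := (((hasDerivAt_id t).const_mul (2 * (x i - y i))).add ((hasDerivAt_id t).pow 2)).const_add (qq y x)
    exact this.congr_deriv (by simp)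
  · simpa using ((hasDerivAt_id (0:ℝ)).const_mul 2).const_add (2 * (x i - y i))

theorem line_min {N : ℕ} {g : (Fin N → ℝ) → ℝ} {z : Fin N → ℝ} (hz : IsLocalMin g z)
    {a b : Fin N → ℝ} (h : ∀ i, D2 (fun t : ℝ => g (z + t • Pi.single i 1)) (a i) (b i)) :
    0 ≤ ∑ i, b i := by
  refine Finset.sum_nonneg fun i _ => (h i).nonneg ?_
  have hc : ContinuousAt (fun t : ℝ => z + t • (Pi.single i 1 : Fin N → ℝ)) 0 := by fun_prop
  have h0 : z + (0:ℝ) • (Pi.single i 1 : Fin N → ℝ) = z := by simp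
  have ht : Tendsto (fun t : ℝ => z + t • (Pi.single i 1 : Fin N → ℝ)) (𝓝 0) (𝓝 z) := by
    have := hc.tendsto
    rwa [h0] at this
  have := ht.eventually hz
  filter_upwards [this] with t ht
  simpa using ht

theorem min_principle {N : ℕ} {g : (Fin N → ℝ) → ℝ} {y : Fin N → ℝ} {r R : ℝ}
    (hg : ContinuousOn g {x | r ≤ qq y x ∧ qq y x ≤ R})
    (hr : ∀ x, qq y x = r → 0 ≤ g x) (hR : ∀ x, qq y x = R → 0 ≤ g x)
    (h : ∀ x, r < qq y x → qq y x < R → g x < 0 → ∃ a b : Fin N → ℝ,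
      (∀ i, D2 (fun t : ℝ => g (x + t • Pi.single i 1)) (a i) (b i)) ∧ ∑ i, b i < 0)
    (x : Fin N → ℝ) (h1 : r ≤ qq y x) (h2 : qq y x ≤ R) : 0 ≤ g x := by
  have hK : IsCompact {x | r ≤ qq y x ∧ qq y x ≤ R} :=
    (qq_compact y R).inter_left (isClosed_le continuous_const (qq_cont y))
  obtain ⟨z, hz, hmin⟩ := hK.exists_isMinOn ⟨x, h1, h2⟩ hg
  by_contra! hx
  have hzx : g z ≤ g x := hmin ⟨h1, h2⟩
  have hzn : g z < 0 := by linarith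
  have z1 : r < qq y z := lt_of_le_of_ne hz.1 fun e => by linarith [hr z e.symm]
  have z2 : qq y z < R := lt_of_le_of_ne hz.2 fun e => by linarith [hR z e]
  obtain ⟨a, b, hab, hb⟩ := h z z1 z2 hzn
  have : IsLocalMin g z := by
    refine hmin.isLocalMin ?_
    filter_upwards [(qq_cont y).continuousAt.eventually (lt_mem_nhds z1),
      (qq_cont y).continuousAt.eventually (gt_mem_nhds z2)] with t p q using ⟨p.le, q.le⟩
  linarith [line_min this hab]

theorem strong_max {N : ℕ} {u k : (Fin N → ℝ) → ℝ} (hu : ContDiff ℝ 2 u) (hk : Continuous k)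
    (hpos : ∀ x, 0 ≤ u x) (heq : ∀ x, -laplacian u x = k x * u x)
    {y : Fin N → ℝ} (hy : 0 < u y) (x : Fin N → ℝ) : 0 < u x := by
  by_contra! hx
  have hx0 : u x = 0 := le_antisymm hx (hpos x)
  -- small radius
  have hex : ∃ r > 0, ∀ z, qq y z ≤ r → u y / 2 ≤ u z := by
    have := hu.continuous.continuousAt.eventually (lt_mem_nhds (show u y / 2 < u y by linarith))
    rw [Metric.eventually_nhds_iff] at this
    obtain ⟨e, he, h⟩ := this
    refine ⟨(e / 2) ^ 2, by positivity, fun z hz => (h ?_).le⟩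
    rw [dist_pi_lt_iff he]
    intro i
    have h1 : (z i - y i) ^ 2 ≤ qq y z :=
      Finset.single_le_sum (f := fun i => (z i - y i) ^ 2) (fun j _ => sq_nonneg _) (mem_univ i)
    rw [Real.dist_eq]
    have := abs_le_of_sq_le_sq (h1.trans hz) (by positivity)
    linarith
  obtain ⟨r, hr, hur⟩ := hex
  set m := u y / 2 with hm
  have hm0 : 0 < m := by positivity
  have hxr : r < qq y x := by
    by_contra! h
    linarith [hur x h]
  set R := qq y x + 1 with hR
  obtain ⟨K, hK⟩ := (qq_compact y R).exists_bound_of_continuousOn hk.continuousOn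
  have hK0 : 0 ≤ |K| := abs_nonneg K
  obtain ⟨α, hα0, hα⟩ : ∃ α : ℝ, 0 < α ∧ |K| < 4 * α ^ 2 * r - 2 * α * N := by
    refine ⟨1 + (|K| + 2 * N) / (4 * r), by positivity, ?_⟩
    set α := 1 + (|K| + 2 * N) / (4 * r) with hα
    have h1 : 4 * α * r = 4 * r + |K| + 2 * N := by rw [hα]; field_simp; ring
    have h2 : 1 ≤ α := by rw [hα]; have : 0 ≤ (|K| + 2 * N) / (4 * r) := by positivity
                          linarith
    have : 4 * α ^ 2 * r - 2 * α * N = α * (4 * r + |K|) := by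
      linear_combination α * h1
    rw [this]; nlinarith
  let g : (Fin N → ℝ) → ℝ := fun z => u z + (-m) * (Real.exp (-α * qq y z) + (- Real.exp (-α * R)))
  have hg : Continuous g := by
    have := qq_cont y
    have := hu.continuous
    fun_prop
  have hh : 0 ≤ g x := by
    refine min_principle (r := r) (R := R) (y := y) hg.continuousOn ?_ ?_ ?_ x hxr.le (by linarith)
    · intro z hz
      have h1 := hur z hz.le
      have h2 : Real.exp (-α * qq y z) ≤ 1 := by
        rw [Real.exp_le_one_iff, hz]; nlinarith
      have h3 := Real.exp_pos (-α * R)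
      simp only [g]; nlinarith
    · intro z hz
      simp only [g, hz]
      simpa using hpos z
    · intro z z1 z2 hz
      refine ⟨_, _, fun i => (D2_line hu z (Pi.single i 1)).add
        (((((qq_line y z i).const_mul (-α)).exp).add (D2.const (- Real.exp (-α * R)))).const_mul (-m)), ?_⟩
      simp only [zero_smul, add_zero]
      set E := Real.exp (-α * qq y z) with hE
      have hE0 : 0 < E := Real.exp_pos _
      have hl : ∑ i, fderiv ℝ (fun y => fderiv ℝ u y (Pi.single i 1)) z (Pi.single i 1)
          = - (k z * u z) := by rw [← heq z, neg_neg]; rfl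
      rw [Finset.sum_add_distrib, hl]
      have : ∑ i : Fin N, -m * (E * (-α * (2 * (z i - y i))) ^ 2 + E * (-α * 2))
          = -m * E * (4 * α ^ 2 * qq y z - 2 * α * N) := by
        have : ∀ i : Fin N, -m * (E * (-α * (2 * (z i - y i))) ^ 2 + E * (-α * 2))
          = -m * E * 4 * α ^ 2 * (z i - y i) ^ 2 + m * E * 2 * α := fun i => by ring
        simp only [this]
        rw [Finset.sum_add_distrib, ← Finset.mul_sum]
        simp only [qq, sum_const, card_univ, Fintype.card_fin, nsmul_eq_mul]; ring
      rw [this]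
      have hkz : -k z ≤ |K| := by
        have := hK z z2.le
        rw [Real.norm_eq_abs] at this
        linarith [neg_abs_le (k z), le_abs_self K]
      have huz : u z ≤ m * E := by
        have h3 := Real.exp_pos (-α * R)
        simp only [g] at hz
        nlinarith
      have e1 : -(k z * u z) ≤ |K| * (m * E) := by
        have := mul_le_mul_of_nonneg_right hkz (hpos z)
        have := mul_le_mul_of_nonneg_left huz hK0
        linarith
      have e2 : |K| < 4 * α ^ 2 * qq y z - 2 * α * N := by
        have : 4 * α ^ 2 * r ≤ 4 * α ^ 2 * qq y z :=
          mul_le_mul_of_nonneg_left z1.le (by positivity)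
        linarith
      have e3 := mul_lt_mul_of_pos_left e2 (mul_pos hm0 hE0)
      linarith
  have : Real.exp (-α * R) < Real.exp (-α * qq y x) := by
    rw [Real.exp_lt_exp]; nlinarith
  simp only [g, hx0] at hh
  nlinarith

theorem liouville {N : ℕ} (hN : N ≤ 2) {w : (Fin N → ℝ) → ℝ} (hw : Continuous w)
    (hpos : ∀ x, 0 ≤ w x)
    (h : ∀ x, ∃ a b : Fin N → ℝ,
      (∀ i, D2 (fun t : ℝ => w (x + t • Pi.single i 1)) (a i) (b i)) ∧ ∑ i, b i < 0) : False := by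
  obtain ⟨z, hz, hmin⟩ := (qq_compact (0 : Fin N → ℝ) 1).exists_isMinOn
    ⟨0, by simp [qq]⟩ hw.continuousOn
  have key : ∀ x, w z ≤ w x := by
    intro x
    by_cases hx : qq 0 x ≤ 1
    · exact hmin hx
    push Not at hx
    by_contra! hlt
    have hL : 0 < Real.log (qq 0 x) := Real.log_pos hx
    obtain ⟨ε, hε, hεx⟩ : ∃ ε > 0, w x - w z + ε * Real.log (qq 0 x) < 0 := by
      refine ⟨(w z - w x) / (2 * Real.log (qq 0 x)), div_pos (by linarith) (by linarith), ?_⟩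
      have : (w z - w x) / (2 * Real.log (qq 0 x)) * Real.log (qq 0 x) = (w z - w x) / 2 := by
        field_simp
      rw [this]; linarith
    let g : (Fin N → ℝ) → ℝ := fun p => (w p + (- w z)) + ε * Real.log (qq 0 p)
    have : 0 ≤ g x := by
      refine min_principle (y := 0) (r := 1) (R := max (qq 0 x) (Real.exp (w z / ε)))
        ?_ ?_ ?_ ?_ x hx.le (le_max_left _ _)
      · have : ContinuousOn (fun p : Fin N → ℝ => Real.log (qq 0 p))
            {p | 1 ≤ qq 0 p ∧ qq 0 p ≤ max (qq 0 x) (Real.exp (w z / ε))} :=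
          (qq_cont 0).continuousOn.log fun p hp => by have := hp.1; linarith
        have := hw.continuousOn (s := {p | 1 ≤ qq 0 p ∧ qq 0 p ≤ max (qq 0 x) (Real.exp (w z / ε))})
        fun_prop
      · intro p hp
        have : w z ≤ w p := hmin hp.le
        simp only [g, hp, Real.log_one]; linarith
      · intro p hp
        have h1 : w z / ε ≤ Real.log (qq 0 p) := by
          rw [hp, Real.le_log_iff_exp_le (lt_max_of_lt_right (Real.exp_pos _))]
          exact le_max_right _ _
        rw [div_le_iff₀ hε] at h1
        have := hpos p
        simp only [g]; linarith
      · intro p p1 p2 _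
        obtain ⟨a, b, hab, hb⟩ := h p
        have q0 : 0 < qq 0 p := by linarith
        refine ⟨_, _, fun i => ((hab i).add (D2.const (- w z))).add
          (((qq_line 0 p i).log (by simpa using q0)).const_mul ε), ?_⟩
        simp only [zero_smul, add_zero]
        rw [Finset.sum_add_distrib]
        have : ∑ i : Fin N, ε * (-(qq 0 p ^ 2)⁻¹ * (2 * (p i - (0 : Fin N → ℝ) i)) ^ 2 + (qq 0 p)⁻¹ * 2)
            = ε * (2 * N - 4) / qq 0 p := by
          have : ∀ i : Fin N, ε * (-(qq 0 p ^ 2)⁻¹ * (2 * (p i - (0 : Fin N → ℝ) i)) ^ 2 + (qq 0 p)⁻¹ * 2)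
            = (-4 * ε * (qq 0 p ^ 2)⁻¹) * (p i - (0 : Fin N → ℝ) i) ^ 2 + ε * (qq 0 p)⁻¹ * 2 := fun i => by ring
          simp only [this]
          rw [Finset.sum_add_distrib, ← Finset.mul_sum]
          change _ * qq 0 p + _ = _
          simp only [sum_const, card_univ, Fintype.card_fin, nsmul_eq_mul]
          field_simp; ring
        rw [this]
        have hN' : (N : ℝ) ≤ 2 := by exact_mod_cast hN
        have : ε * (2 * N - 4) / qq 0 p ≤ 0 :=
          div_nonpos_of_nonpos_of_nonneg (by nlinarith) q0.le
        linarith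
    simp only [g] at this
    linarith
  obtain ⟨a, b, hab, hb⟩ := h z
  have : IsLocalMin w z := Eventually.of_forall key
  linarith [line_min this hab]

theorem exists_weight {n : ℕ} (B : Matrix (Fin n) (Fin n) ℝ) (hsym : B.IsSymm)
    (hcop : (∀ c : Fin n → ℝ, (∀ i, 0 ≤ c i) → c ≠ 0 → 0 < ∑ i, ∑ j, B i j * c i * c j))
    (S : Set (Fin n)) (hS : S.Nonempty) :
    ∃ c : Fin n → ℝ, (∀ i, 0 ≤ c i) ∧ ∑ i, c i = 1 ∧ (∀ i, i ∉ S → c i = 0) ∧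
      ∀ j ∈ S, 0 < ∑ i, c i * B i j := by
  classical
  let Q : (Fin n → ℝ) → ℝ := fun c => ∑ i, ∑ j, B i j * c i * c j
  have hQ : Continuous Q := by fun_prop
  have hK : IsCompact (stdSimplex ℝ (Fin n) ∩ {c | ∀ i, i ∉ S → c i = 0}) := by
    refine (isCompact_stdSimplex ℝ (Fin n)).inter_right ?_
    simp only [Set.ofPred_forall]
    exact isClosed_iInter fun i => isClosed_iInter fun _ =>
      isClosed_eq (continuous_apply i) continuous_const
  have hsingle : ∀ j ∈ S, (Pi.single j 1 : Fin n → ℝ) ∈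
      stdSimplex ℝ (Fin n) ∩ {c | ∀ i, i ∉ S → c i = 0} := fun j hj =>
    ⟨single_mem_stdSimplex ℝ j, fun i hi => by
      rw [Pi.single_apply, if_neg]; rintro rfl; exact hi hj⟩
  obtain ⟨j0, hj0⟩ := hS
  obtain ⟨c, ⟨⟨hc0, hc1⟩, hcS⟩, hmin⟩ := hK.exists_isMinOn ⟨_, hsingle j0 hj0⟩ hQ.continuousOn
  refine ⟨c, hc0, hc1, hcS, fun j hj => ?_⟩
  have hcne : c ≠ 0 := by rintro rfl; simp at hc1
  have hQc : 0 < Q c := hcop c hc0 hcne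
  set L := ∑ i, c i * B i j with hL
  have expand : ∀ t : ℝ, Q (fun i => (1 - t) * c i + t * (Pi.single j 1 : Fin n → ℝ) i)
      = (1 - t) ^ 2 * Q c + 2 * t * (1 - t) * L + t ^ 2 * B j j := by
    intro t
    have e1 : ∀ i k, B i k * ((1 - t) * c i + t * (Pi.single j 1 : Fin n → ℝ) i) *
        ((1 - t) * c k + t * (Pi.single j 1 : Fin n → ℝ) k) =
        (1 - t) ^ 2 * (B i k * c i * c k)
        + t * (1 - t) * (B i k * c i * (Pi.single j 1 : Fin n → ℝ) k)
        + t * (1 - t) * (B i k * c k * (Pi.single j 1 : Fin n → ℝ) i)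
        + t ^ 2 * (B i k * (Pi.single j 1 : Fin n → ℝ) k * (Pi.single j 1 : Fin n → ℝ) i) :=
      fun i k => by ring
    have e2 : ∑ i, ∑ k, B i k * c i * (Pi.single j 1 : Fin n → ℝ) k = L := by
      simp [Pi.single_apply, hL, mul_comm]
    have e3 : ∑ i, ∑ k, B i k * c k * (Pi.single j 1 : Fin n → ℝ) i = L := by
      rw [Finset.sum_comm]
      simp only [Pi.single_apply, mul_ite, mul_one, mul_zero, Finset.sum_ite_eq', mem_univ, if_true, hL]
      refine Finset.sum_congr rfl fun k _ => ?_
      rw [hsym.apply j k |>.symm]; ring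
    have e4 : ∑ i, ∑ k, (B i k * (Pi.single j 1 : Fin n → ℝ) k * (Pi.single j 1 : Fin n → ℝ) i) = B j j := by
      simp [Pi.single_apply]
    simp only [Q, e1, Finset.sum_add_distrib, ← Finset.mul_sum, e2, e3, e4]
    ring
  have hle : ∀ t : ℝ, 0 ≤ t → t ≤ 1 →
      Q c ≤ (1 - t) ^ 2 * Q c + 2 * t * (1 - t) * L + t ^ 2 * B j j := by
    intro t t0 t1
    rw [← expand t]
    refine hmin ⟨?_, fun i hi => ?_⟩
    · exact convex_stdSimplex ℝ (Fin n) ⟨hc0, hc1⟩ (hsingle j hj).1 (by linarith) t0 (by ring)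
    · show (1 - t) * c i + t * (Pi.single j 1 : Fin n → ℝ) i = 0
      rw [hcS i hi, (hsingle j hj).2 i hi]; ring
  by_contra! hLn
  set b := |B j j| with hb
  have hb0 : 0 ≤ b := abs_nonneg _
  have hbb : B j j ≤ b := le_abs_self _
  set t := Q c / (Q c + b) with ht
  have hd : 0 < Q c + b := by linarith
  have htpos : 0 < t := div_pos hQc hd
  have ht1 : t ≤ 1 := by rw [ht, div_le_one hd]; linarith
  have htm : t * (Q c + b) = Q c := by rw [ht]; field_simp
  have h1 := hle t htpos.le ht1
  have h2 : 2 * t * (1 - t) * L ≤ 0 := mul_nonpos_of_nonneg_of_nonpos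
    (mul_nonneg (by linarith) (by linarith)) hLn
  have h3 : t ^ 2 * B j j ≤ t ^ 2 * b := mul_le_mul_of_nonneg_left hbb (by positivity)
  have h4 : t ^ 2 * (Q c + b) = t * Q c := by linear_combination t * htm
  nlinarith [mul_pos htpos hQc]

theorem stmt_5 (N n : ℕ) (hN1 : 1 ≤ N) (hN : N ≤ 2) (hn : 2 ≤ n)
    (B : Matrix (Fin n) (Fin n) ℝ) (hsym : B.IsSymm)
    (hcop : (∀ c : Fin n → ℝ, (∀ i, 0 ≤ c i) → c ≠ 0 → 0 < ∑ i, ∑ j, B i j * c i * c j))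
    (u : Fin n → (Fin N → ℝ) → ℝ)
    (hreg : ∀ i, ContDiff ℝ 2 (u i))
    (hpos : ∀ i x, 0 ≤ u i x)
    (heq : ∀ i x, -laplacian (u i) x = ∑ j, B i j * (u j x) ^ 2 * u i x) :
    ∀ i, u i = 0 := by
  classical
  by_contra! hne
  obtain ⟨c, hc0, hc1, hcS, hcB⟩ := exists_weight B hsym hcop {i | u i ≠ 0} hne
  have hcont : ∀ i, Continuous (u i) := fun i => (hreg i).continuous
  have hup : ∀ i, u i ≠ 0 → ∀ x, 0 < u i x := by
    intro i hi
    obtain ⟨y, hy⟩ := Function.ne_iff.1 hi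
    refine strong_max (k := fun x => ∑ j, B i j * (u j x) ^ 2) (hreg i) (by fun_prop) (hpos i)
      (fun x => by rw [heq i x, Finset.sum_mul]) (lt_of_le_of_ne (hpos i y) (Ne.symm hy))
  set T : Finset (Fin n) := univ.filter fun i => u i ≠ 0 with hT
  have hTp : ∀ i ∈ T, ∀ x, 0 < u i x := fun i hi => hup i (by simpa [hT] using hi)
  have hTsum : ∀ f : Fin n → ℝ, ∑ i ∈ T, c i * f i = ∑ i, c i * f i := fun f =>
    Finset.sum_subset (subset_univ _) fun i _ hi => by
      rw [hcS i (by simpa [hT] using hi), zero_mul]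
  refine liouville hN (w := fun x => Real.exp (∑ i ∈ T, c i * Real.log (u i x))) ?_
    (fun x => (Real.exp_pos _).le) ?_
  · refine Real.continuous_exp.comp (continuous_finsetSum _ fun i hi => ?_)
    exact continuous_const.mul ((hcont i).log fun x => (hTp i hi x).ne')
  intro x
  refine ⟨_, _, fun k => (D2.sum T fun i hi => ((D2_line (hreg i) x (Pi.single k 1)).log
    (by simpa using hTp i hi x)).const_mul (c i)).exp, ?_⟩
  simp only [zero_smul, add_zero]
  set W := Real.exp (∑ i ∈ T, c i * Real.log (u i x)) with hW
  have hW0 : 0 < W := Real.exp_pos _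
  have hk : ∀ k : Fin N, ∀ a b : Fin n → ℝ,
      W * (∑ i ∈ T, c i * ((u i x)⁻¹ * a i)) ^ 2
       + W * ∑ i ∈ T, c i * (-((u i x) ^ 2)⁻¹ * a i ^ 2 + (u i x)⁻¹ * b i)
      ≤ W * ∑ i ∈ T, c i * ((u i x)⁻¹ * b i) := by
    intro k a b
    have hJ : (∑ i ∈ T, c i * ((u i x)⁻¹ * a i)) ^ 2 ≤ ∑ i ∈ T, c i * ((u i x)⁻¹ * a i) ^ 2 := by
      have h1 : ∑ i ∈ T, c i = 1 := by simpa [hc1] using hTsum fun _ => 1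
      exact (Even.convexOn_pow (n := 2) (by norm_num)).map_sum_le (w := c)
        (fun i _ => hc0 i) h1 (fun i _ => Set.mem_univ ((u i x)⁻¹ * a i))
    rw [← mul_add]
    refine mul_le_mul_of_nonneg_left ?_ hW0.le
    have : ∑ i ∈ T, c i * (-((u i x) ^ 2)⁻¹ * a i ^ 2 + (u i x)⁻¹ * b i)
        = ∑ i ∈ T, c i * ((u i x)⁻¹ * b i) - ∑ i ∈ T, c i * ((u i x)⁻¹ * a i) ^ 2 := by
      rw [← Finset.sum_sub_distrib]
      refine Finset.sum_congr rfl fun i _ => ?_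
      rw [mul_pow, inv_pow]; ring
    rw [this]; linarith
  refine lt_of_le_of_lt (Finset.sum_le_sum fun k _ => hk k _ _) ?_
  rw [← Finset.mul_sum]
  refine mul_neg_of_pos_of_neg hW0 ?_
  rw [Finset.sum_comm]
  have hlap : ∀ i ∈ T, ∑ k, c i * ((u i x)⁻¹ *
      fderiv ℝ (fun y => fderiv ℝ (u i) y (Pi.single k 1)) x (Pi.single k 1))
      = - (c i * ∑ j, B i j * u j x ^ 2) := by
    intro i hi
    have hui := (hTp i hi x).ne'
    rw [← Finset.mul_sum, ← Finset.mul_sum]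
    change c i * ((u i x)⁻¹ * laplacian (u i) x) = _
    have : laplacian (u i) x = - ((∑ j, B i j * u j x ^ 2) * u i x) := by
      rw [Finset.sum_mul, ← heq i x, neg_neg]
    rw [this]; field_simp
  rw [Finset.sum_congr rfl hlap, Finset.sum_neg_distrib, neg_lt_zero,
    hTsum fun i => ∑ j, B i j * u j x ^ 2]
  have : ∑ i, c i * ∑ j, B i j * u j x ^ 2 = ∑ j, (∑ i, c i * B i j) * u j x ^ 2 := by
    simp only [Finset.mul_sum, Finset.sum_mul]
    rw [Finset.sum_comm]
    exact Finset.sum_congr rfl fun _ _ => Finset.sum_congr rfl fun _ _ => by ring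
  rw [this]
  obtain ⟨j0, hj0⟩ := hne
  refine Finset.sum_pos' (fun j _ => ?_) ⟨j0, mem_univ _, mul_pos (hcB j0 hj0) (pow_pos (hup j0 hj0 x) 2)⟩
  by_cases hj : u j = 0
  · simp [hj]
  · exact mul_nonneg (hcB j hj).le (sq_nonneg _)
end
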